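/- arXiv:2307.13535 — 2 statements merged into one kernel-verified Lean document; each statement's English description precedes it below -/
import Mathlib

section
/- There exists a universal constant c > 0 such that the following holds. Let d, k be integers with k dividing d − 2, d ≥ 16k², and k ≥ 4, and let λ > 0, n ≥ 1. Then for every measurable estimator v̂ : (ℝ^d)^n → ℝ^d there exists a k-path-sparse unit vector v* ∈ S^{d−1} such that, with x_1, …, x_n the spiked Wishart samples with spike v*, E[‖v̂(x_1,…,x_n) v̂(x_1,…,x_n)ᵀ − v* v*ᵀ‖_F] ≥ c · min{ 1 , √((1+λ)/(8λ²)) · √( k·((ln d)/2 − ln k) / n ) }. -/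
open MeasureTheory ProbabilityTheory Matrix Finset

noncomputable section

namespace StructuredPCA

/-- Euclidean inner product on `Fin d → ℝ`. -/
def ip {d : ℕ} (u v : Fin d → ℝ) : ℝ := ∑ i, u i * v i

/-- Euclidean norm on `Fin d → ℝ`. -/
def nrm {d : ℕ} (v : Fin d → ℝ) : ℝ := Real.sqrt (∑ i, v i ^ 2)

/-- Quadratic form `vᵀ A v`. -/
def quad {d : ℕ} (A : Matrix (Fin d) (Fin d) ℝ) (v : Fin d → ℝ) : ℝ := ip v (A.mulVec v)

/-- `ρ(A, S) = sup { |vᵀ A v| : v ∈ S, ‖v‖ = 1 }`. -/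
def rho {d : ℕ} (A : Matrix (Fin d) (Fin d) ℝ) (S : Set (Fin d → ℝ)) : ℝ :=
  sSup {x : ℝ | ∃ v ∈ S, nrm v = 1 ∧ x = |quad A v|}

/-- Frobenius norm of a matrix. -/
def frob {d : ℕ} (A : Matrix (Fin d) (Fin d) ℝ) : ℝ :=
  Real.sqrt (∑ i, ∑ j, A i j ^ 2)

/-- Operator (spectral) norm of a matrix. -/
def opNorm {d : ℕ} (A : Matrix (Fin d) (Fin d) ℝ) : ℝ :=
  sSup {x : ℝ | ∃ v, nrm v = 1 ∧ x = nrm (A.mulVec v)}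

/-- The spiked covariance `λ v* v*ᵀ + I`. -/
def spikedCov {d : ℕ} (lam : ℝ) (vstar : Fin d → ℝ) : Matrix (Fin d) (Fin d) ℝ :=
  lam • vecMulVec vstar vstar + 1

/-- `x 1, …, x n` are spiked Wishart samples with spike `v*`:
`x i = √λ g i • v* + z i` with `g, z` i.i.d. standard normal, mutually independent. -/
def IsSpikedWishart {d n : ℕ} {Ω : Type*} [MeasurableSpace Ω] (μ : Measure Ω)
    (lam : ℝ) (vstar : Fin d → ℝ) (x : Fin n → Ω → Fin d → ℝ) : Prop :=
  ∃ G : (Fin n ⊕ Fin n × Fin d) → Ω → ℝ,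
    (∀ i, Measurable (G i)) ∧
    iIndepFun G μ ∧
    (∀ i, μ.map (G i) = gaussianReal 0 1) ∧
    ∀ i ω j, x i ω j = Real.sqrt lam * G (Sum.inl i) ω * vstar j + G (Sum.inr (i, j)) ω

/-- The sample covariance matrix `n⁻¹ ∑ xᵢ xᵢᵀ`. -/
def sampleCov {d n : ℕ} {Ω : Type*} (x : Fin n → Ω → Fin d → ℝ) (ω : Ω) :
    Matrix (Fin d) (Fin d) ℝ :=
  (n : ℝ)⁻¹ • ∑ i, vecMulVec (x i ω) (x i ω)

/-- Union-of-linear-structures data: an orthonormal basis `φ` and subsets `Bs m`. -/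
structure UnionStruct (d M : ℕ) where
  φ : Fin d → Fin d → ℝ
  orthonormal : ∀ i j, ip (φ i) (φ j) = if i = j then 1 else 0
  Bs : Fin M → Finset (Fin d)

/-- The subspace `L m = span (B m)`. -/
def UnionStruct.L {d M : ℕ} (U : UnionStruct d M) (m : Fin M) : Submodule ℝ (Fin d → ℝ) :=
  Submodule.span ℝ (U.φ '' (U.Bs m : Set (Fin d)))

/-- The union `𝓜 = ⋃ m, L m`. -/
def UnionStruct.carrier {d M : ℕ} (U : UnionStruct d M) : Set (Fin d → ℝ) :=
  ⋃ m, (U.L m : Set (Fin d → ℝ))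

/-- A `(d,k)`-layered graph. -/
structure LayeredGraph (d k : ℕ) where
  vs : Fin d
  vt : Fin d
  hst : vs ≠ vt
  V : Fin k → Finset (Fin d)
  hvs : ∀ j, vs ∉ V j
  hvt : ∀ j, vt ∉ V j
  hdisj : ∀ j j', j ≠ j' → Disjoint (V j) (V j')
  hdvd : k ∣ (d - 2)
  hcard : ∀ j, (V j).card = (d - 2) / k
  hcover : ∀ i, i ≠ vs → i ≠ vt → ∃ j, i ∈ V j

/-- A member of `P^k`: contains `v_s`, `v_t` and exactly one vertex of each layer. -/
def LayeredGraph.IsPathSet {d k : ℕ} (G : LayeredGraph d k) (P : Finset (Fin d)) : Prop :=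
  G.vs ∈ P ∧ G.vt ∈ P ∧ ∀ j, (P ∩ G.V j).card = 1

/-- `v` is `k`-path-sparse. -/
def LayeredGraph.PathSparse {d k : ℕ} (G : LayeredGraph d k) (v : Fin d → ℝ) : Prop :=
  ∃ P, G.IsPathSet P ∧ ∀ i, v i ≠ 0 → i ∈ P

/-- A member of `T^k`: a `k`-element rooted connected subtree of the complete binary
tree on nodes `1, …, d` (node `i ≥ 2` has parent `i / 2`). -/
def IsTreeSet (d k : ℕ) (T : Finset ℕ) : Prop :=
  T.card = k ∧ 1 ∈ T ∧ (∀ i ∈ T, 1 ≤ i ∧ i ≤ d) ∧ ∀ i ∈ T, 2 ≤ i → i / 2 ∈ T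

/-- `v` is `k`-tree-sparse (coordinate `i : Fin d` corresponds to node `i + 1`). -/
def TreeSparse (d k : ℕ) (v : Fin d → ℝ) : Prop :=
  ∃ T, IsTreeSet d k T ∧ ∀ i : Fin d, v i ≠ 0 → (i : ℕ) + 1 ∈ T

/-- The index of the parent node: coordinate `i` is node `i+1`, whose parent is `(i+1)/2`. -/
def parentIdx {d : ℕ} (i : Fin d) : Fin d :=
  ⟨((i : ℕ) + 1) / 2 - 1, by have := i.isLt; omega⟩

/-- The feasible set of the SDP relaxation for tree-sparse PCA. -/
def sdpFeasible (d k : ℕ) : Set (Matrix (Fin d) (Fin d) ℝ) :=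
  {Mm | Mm.PosSemidef ∧ (∑ i, Mm i i) = 1 ∧ (∑ i, ∑ j, |Mm i j|) ≤ (k : ℝ) ∧
    ∀ i : Fin d, 2 ≤ (i : ℕ) + 1 → Mm i i ≤ Mm (parentIdx i) (parentIdx i)}




lemma lintegral_pi_prod {ι : Type*} [Fintype ι] (f : ι → ℝ → ENNReal)
    (hf : ∀ i, Measurable (f i)) :
    ∫⁻ x, ∏ i, f i (x i) ∂(Measure.pi fun _ : ι => (gaussianReal 0 1)) = ∏ i, ∫⁻ t, f i t ∂(gaussianReal 0 1) := by
  have h := lintegral_prod_eq_prod_lintegral_of_indepFun (μ := Measure.pi fun _ : ι => (gaussianReal 0 1))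
    Finset.univ (fun i x => f i (x i))
    (iIndepFun_pi (X := fun i => f i) fun i => (hf i).aemeasurable)
    (fun i => (hf i).comp (measurable_pi_apply i))
  rw [h]
  refine Finset.prod_congr rfl fun i _ => ?_
  exact MeasurePreserving.lintegral_comp (measurePreserving_eval (fun _ : ι => (gaussianReal 0 1)) i) (hf i)

lemma gauss_shift (a : ℝ) :
    (gaussianReal 0 1).map (fun x => x + a) =
      (gaussianReal 0 1).withDensity (fun x => ENNReal.ofReal (Real.exp (a * x - a ^ 2 / 2))) := by
  rw [gaussianReal_map_add_const, gaussianReal_of_var_ne_zero _ one_ne_zero,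
    gaussianReal_of_var_ne_zero _ one_ne_zero, ← withDensity_mul _ (by fun_prop) (by fun_prop)]
  congr 1
  ext x
  simp only [gaussianPDF, Pi.mul_apply, gaussianPDFReal]
  rw [← ENNReal.ofReal_mul (by positivity), mul_assoc _ (Real.exp _), ← Real.exp_add]
  congr 3
  simp
  ring

lemma pi_shift {ι : Type*} [Fintype ι] (a : ι → ℝ) :
    (Measure.pi fun _ : ι => (gaussianReal 0 1)).map (fun z i => z i + a i) =
      (Measure.pi fun _ : ι => (gaussianReal 0 1)).withDensity
        (fun x => ∏ i, ENNReal.ofReal (Real.exp (a i * x i - a i ^ 2 / 2))) := by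
  rw [Measure.pi_map_pi (f := fun i z => z + a i) (fun i => by fun_prop)]
  refine Measure.pi_eq fun s hs => ?_
  rw [withDensity_apply _ (MeasurableSet.univ_pi hs), ← lintegral_indicator (MeasurableSet.univ_pi hs)]
  have : ∀ x : ι → ℝ, (Set.univ.pi s).indicator
      (fun x => ∏ i, ENNReal.ofReal (Real.exp (a i * x i - a i ^ 2 / 2))) x =
      ∏ i, (s i).indicator (fun t => ENNReal.ofReal (Real.exp (a i * t - a i ^ 2 / 2))) (x i) := by
    intro x
    by_cases hx : x ∈ Set.univ.pi s
    · rw [Set.indicator_of_mem hx]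
      refine Finset.prod_congr rfl fun i _ => ?_
      rw [Set.indicator_of_mem (hx i (Set.mem_univ i))]
    · rw [Set.indicator_of_notMem hx]
      simp only [Set.mem_univ_pi, not_forall] at hx
      obtain ⟨i, hi⟩ := hx
      exact (Finset.prod_eq_zero (Finset.mem_univ i) (Set.indicator_of_notMem hi _)).symm
  simp_rw [this]
  rw [lintegral_pi_prod _ (fun i => Measurable.indicator (by fun_prop) (hs i))]
  refine Finset.prod_congr rfl fun i _ => ?_
  rw [gauss_shift, withDensity_apply _ (hs i), lintegral_indicator (hs i)]

lemma gauss_mix (lam : ℝ) (hl : 0 < lam) (s : ℝ) :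
    ∫⁻ g, ENNReal.ofReal (Real.exp (Real.sqrt lam * g * s - lam * g ^ 2 / 2)) ∂(gaussianReal 0 1) =
      ENNReal.ofReal ((Real.sqrt (1 + lam))⁻¹ * Real.exp (lam / (2 * (1 + lam)) * s ^ 2)) := by
  rw [gaussianReal_of_var_ne_zero _ one_ne_zero,
    lintegral_withDensity_eq_lintegral_mul _ (by fun_prop) (by fun_prop)]
  set v : NNReal := ⟨(1 + lam)⁻¹, by positivity⟩ with hv
  have hvc : (v : ℝ) = (1 + lam)⁻¹ := rfl
  have hv0 : v ≠ 0 := by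
    intro h
    have : (v : ℝ) = 0 := by rw [h]; rfl
    rw [hvc] at this
    have : 0 < (1 + lam)⁻¹ := by positivity
    linarith
  set m : ℝ := Real.sqrt lam * s / (1 + lam) with hm
  set C : ℝ := (Real.sqrt (1 + lam))⁻¹ * Real.exp (lam / (2 * (1 + lam)) * s ^ 2)
  have key : ∀ g : ℝ, (gaussianPDF 0 1 * fun g =>
      ENNReal.ofReal (Real.exp (Real.sqrt lam * g * s - lam * g ^ 2 / 2))) g =
      ENNReal.ofReal C * gaussianPDF m v g := by
    intro g
    simp only [Pi.mul_apply, gaussianPDF]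
    rw [← ENNReal.ofReal_mul (gaussianPDFReal_nonneg _ _ _), ← ENNReal.ofReal_mul (by positivity)]
    congr 1
    simp only [gaussianPDFReal, hvc, C]
    have h1 : Real.sqrt (2 * Real.pi * (1 + lam)⁻¹) = Real.sqrt (2 * Real.pi) * (Real.sqrt (1 + lam))⁻¹ := by
      rw [Real.sqrt_mul (by positivity), Real.sqrt_inv]
    rw [h1]
    have h2 : lam / (2 * (1 + lam)) * s ^ 2 + -(g - m) ^ 2 / (2 * (1 + lam)⁻¹)
       = -(g - 0) ^ 2 / (2 * 1) + (Real.sqrt lam * g * s - lam * g ^ 2 / 2) := by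
      have h3 : Real.sqrt lam ^ 2 = lam := Real.sq_sqrt hl.le
      rw [hm]
      generalize Real.sqrt lam = r at *
      subst h3
      field_simp
      ring
    have h4 : 0 < Real.sqrt (1 + lam) := by positivity
    have h5 : 0 < Real.sqrt (2 * Real.pi) := by positivity
    calc _ = (Real.sqrt (2 * Real.pi))⁻¹ * (Real.exp (-(g - 0) ^ 2 / (2 * 1)) * Real.exp (Real.sqrt lam * g * s - lam * g ^ 2 / 2)) := by
            simp; ring
      _ = (Real.sqrt (2 * Real.pi))⁻¹ * (Real.exp (lam / (2 * (1 + lam)) * s ^ 2) * Real.exp (-(g - m) ^ 2 / (2 * (1 + lam)⁻¹))) := by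
            rw [← Real.exp_add, ← Real.exp_add, h2]
      _ = _ := by field_simp
  rw [lintegral_congr key, lintegral_const_mul _ (by fun_prop), lintegral_gaussianPDF_eq_one _ hv0,
    mul_one]

/-- inner product of the `i`-th sample with `v` -/
def sp {n d : ℕ} (v : Fin d → ℝ) (x : Fin n × Fin d → ℝ) (i : Fin n) : ℝ := ∑ j, v j * x (i, j)

/-- density of the spiked model with respect to the standard Gaussian -/
def dens {n d : ℕ} (lam : ℝ) (v : Fin d → ℝ) (x : Fin n × Fin d → ℝ) : ℝ :=
  ∏ i : Fin n, ((Real.sqrt (1 + lam))⁻¹ * Real.exp (lam / (2 * (1 + lam)) * (sp v x i) ^ 2))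

def obs {n d : ℕ} (lam : ℝ) (v : Fin d → ℝ) (y : Fin n ⊕ Fin n × Fin d → ℝ) :
    Fin n × Fin d → ℝ :=
  fun p => Real.sqrt lam * y (Sum.inl p.1) * v p.2 + y (Sum.inr p)

def Ref (n d : ℕ) : Measure (Fin n × Fin d → ℝ) := Measure.pi fun _ => (gaussianReal 0 1)

def Law (n : ℕ) {d : ℕ} (lam : ℝ) (v : Fin d → ℝ) : Measure (Fin n × Fin d → ℝ) :=
  (Measure.pi fun _ : Fin n ⊕ Fin n × Fin d => (gaussianReal 0 1)).map (obs lam v)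

lemma measurable_obs {n d : ℕ} (lam : ℝ) (v : Fin d → ℝ) : Measurable (obs (n := n) lam v) := by
  unfold obs; fun_prop

lemma measurable_sp {n d : ℕ} (v : Fin d → ℝ) (i : Fin n) :
    Measurable (fun x : Fin n × Fin d → ℝ => sp v x i) := by
  unfold sp; fun_prop

lemma measurable_dens {n d : ℕ} (lam : ℝ) (v : Fin d → ℝ) : Measurable (dens (n := n) lam v) := by
  unfold dens
  refine Finset.measurable_prod _ fun i _ => ?_
  have := measurable_sp (n := n) v i
  fun_prop

lemma dens_pos {n d : ℕ} (lam : ℝ) (hl : 0 < lam) (v : Fin d → ℝ) (x : Fin n × Fin d → ℝ) :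
    0 < dens lam v x := by
  unfold dens
  refine Finset.prod_pos fun i _ => ?_
  positivity

instance (n d : ℕ) : IsProbabilityMeasure (Ref n d) := by unfold Ref; infer_instance

instance (n : ℕ) {d : ℕ} (lam : ℝ) (v : Fin d → ℝ) : IsProbabilityMeasure (Law n lam v) := by
  unfold Law; exact Measure.isProbabilityMeasure_map (measurable_obs lam v).aemeasurable

lemma law_eq (n : ℕ) {d : ℕ} (lam : ℝ) (hl : 0 < lam) (v : Fin d → ℝ) (hv : ∑ j, v j ^ 2 = 1) :
    Law n lam v = (Ref n d).withDensity (fun x => ENNReal.ofReal (dens lam v x)) := by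
  refine Measure.ext_of_lintegral _ fun F hF => ?_
  have hd : Measurable (fun x : Fin n × Fin d → ℝ => ENNReal.ofReal (dens lam v x)) :=
    (measurable_dens lam v).ennreal_ofReal
  rw [lintegral_withDensity_eq_lintegral_mul _ hd hF, Law, lintegral_map hF (measurable_obs lam v)]
  have hmp := measurePreserving_sumPiEquivProdPi (X := fun _ : Fin n ⊕ Fin n × Fin d => ℝ)
    (fun _ => (gaussianReal 0 1))
  set Γ := Measure.pi fun _ : Fin n => (gaussianReal 0 1)
  have hmeas : Measurable (fun p : (Fin n → ℝ) × (Fin n × Fin d → ℝ) =>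
      F (fun q => p.2 q + Real.sqrt lam * p.1 q.1 * v q.2)) := hF.comp (by fun_prop)
  have h1 : ∫⁻ y, F (obs lam v y) ∂(Measure.pi fun _ : Fin n ⊕ Fin n × Fin d => (gaussianReal 0 1)) =
      ∫⁻ p, F (fun q => p.2 q + Real.sqrt lam * p.1 q.1 * v q.2) ∂(Γ.prod (Ref n d)) := by
    rw [Ref, ← MeasurePreserving.lintegral_comp hmp hmeas]
    refine lintegral_congr fun y => ?_
    congr 1
    ext q
    simp only [obs, MeasurableEquiv.coe_sumPiEquivProdPi, Equiv.sumPiEquivProdPi]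
    exact add_comm _ _
  rw [h1, lintegral_prod _ hmeas.aemeasurable]
  have h2 : ∀ g : Fin n → ℝ, ∫⁻ z, F (fun q => z q + Real.sqrt lam * g q.1 * v q.2) ∂(Ref n d) =
      ∫⁻ x, (∏ i, ENNReal.ofReal (Real.exp (Real.sqrt lam * g i * sp v x i - lam * g i ^ 2 / 2)))
        * F x ∂(Ref n d) := by
    intro g
    have hs := pi_shift (ι := Fin n × Fin d) (fun q => Real.sqrt lam * g q.1 * v q.2)
    rw [← lintegral_map (f := F) (g := fun (z : Fin n × Fin d → ℝ) q => z q + Real.sqrt lam * g q.1 * v q.2)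
      hF (by fun_prop), Ref, hs, lintegral_withDensity_eq_lintegral_mul _ (by fun_prop) hF]
    refine lintegral_congr fun x => ?_
    simp only [Pi.mul_apply]
    congr 1
    rw [Fintype.prod_prod_type]
    refine Finset.prod_congr rfl fun i _ => ?_
    rw [← ENNReal.ofReal_prod_of_nonneg (fun j _ => (Real.exp_pos _).le), ← Real.exp_sum]
    congr 2
    rw [Finset.sum_sub_distrib]
    congr 1
    · simp only [sp, Finset.mul_sum]
      exact Finset.sum_congr rfl fun j _ => by ring
    · have : ∀ j, (Real.sqrt lam * g i * v j) ^ 2 / 2 = lam * g i ^ 2 / 2 * v j ^ 2 := by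
        intro j
        rw [mul_pow, mul_pow, Real.sq_sqrt hl.le]; ring
      simp only [this]
      rw [← Finset.mul_sum, hv, mul_one]
  simp_rw [h2]
  have hm : ∀ i, Measurable (fun p : (Fin n → ℝ) × (Fin n × Fin d → ℝ) => sp v p.2 i) :=
    fun i => (measurable_sp v i).comp measurable_snd
  rw [lintegral_lintegral_swap]
  · refine lintegral_congr fun x => ?_
    rw [lintegral_mul_const _ (by fun_prop)]
    simp only [Pi.mul_apply]
    congr 1
    rw [lintegral_pi_prod (fun i t => ENNReal.ofReal (Real.exp (Real.sqrt lam * t * sp v x i - lam * t ^ 2 / 2))) (fun i => by fun_prop)]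
    simp_rw [gauss_mix lam hl]
    rw [dens, ENNReal.ofReal_prod_of_nonneg (fun i _ => by positivity)]
  · refine Measurable.aemeasurable ?_
    refine Measurable.mul ?_ (hF.comp measurable_snd)
    refine Finset.measurable_prod _ fun i _ => ?_
    have := hm i
    fun_prop

lemma law_apply {d n : ℕ} {Ω : Type*} [MeasurableSpace Ω] (μ : Measure Ω) [IsProbabilityMeasure μ]
    (lam : ℝ) (v : Fin d → ℝ) (x : Fin n → Ω → Fin d → ℝ) (h : IsSpikedWishart μ lam v x)
    (F : (Fin n → Fin d → ℝ) → ENNReal) (hF : Measurable F) :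
    ∫⁻ ω, F (fun i => x i ω) ∂μ = ∫⁻ y, F (fun i j => y (i, j)) ∂(Law n lam v) := by
  obtain ⟨G, hG, hi, hl, hx⟩ := h
  have hm := (iIndepFun_iff_map_fun_eq_pi_map (fun i => (hG i).aemeasurable)).1 hi
  simp_rw [hl] at hm
  have hc : Measurable (fun y : Fin n × Fin d → ℝ => F (fun i j => y (i, j))) := hF.comp (by fun_prop)
  rw [Law, lintegral_map hc (measurable_obs lam v), ← hm]
  have := lintegral_map (μ := μ) (f := fun y => F (fun i j => obs lam v y (i, j)))
    (hc.comp (measurable_obs lam v)) (g := fun ω i => G i ω) (by fun_prop)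
  rw [this]
  refine lintegral_congr fun ω => ?_
  congr 1
  ext i j
  rw [hx]
  rfl

lemma lin_memLp {ι : Type*} [Fintype ι] (c : ι → ℝ) :
    MemLp (fun y : ι → ℝ => ∑ a, c a * y a) 2 (Measure.pi fun _ : ι => (gaussianReal 0 1)) := by
  refine memLp_finsetSum _ fun a _ => ?_
  have h := (memLp_id_gaussianReal (μ := 0) (v := 1) 2).comp_measurePreserving
    (measurePreserving_eval (fun _ : ι => (gaussianReal 0 1)) a)
  exact h.const_mul (c a)

lemma lin_moment {ι : Type*} [Fintype ι] (c : ι → ℝ) :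
    ∫ y : ι → ℝ, (∑ a, c a * y a) ^ 2 ∂(Measure.pi fun _ : ι => (gaussianReal 0 1)) = ∑ a, c a ^ 2 := by
  have hid : ∀ a, MemLp (fun t : ℝ => c a * t) 2 (gaussianReal 0 1) := fun a =>
    (memLp_id_gaussianReal (μ := 0) (v := 1) 2).const_mul (c a)
  have hv := variance_sum_pi (μ := fun _ : ι => (gaussianReal 0 1)) (X := fun a t => c a * t) hid
  have hz : ∫ y : ι → ℝ, (∑ a, c a * y a) ∂(Measure.pi fun _ : ι => (gaussianReal 0 1)) = 0 := by
    rw [integral_finsetSum]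
    · refine Finset.sum_eq_zero fun a _ => ?_
      rw [integral_comp_eval (μ := fun _ : ι => (gaussianReal 0 1)) (i := a) (f := fun t => c a * t)
        (hid a).aestronglyMeasurable, integral_const_mul, integral_id_gaussianReal, mul_zero]
    · intro a _
      exact ((hid a).comp_measurePreserving
        (measurePreserving_eval (fun _ : ι => (gaussianReal 0 1)) a)).integrable (by norm_num)
  have e : (∑ i, fun ω : ι → ℝ => c i * ω i) = fun y : ι → ℝ => ∑ a, c a * y a := by
    ext y; simp
  rw [e, variance_of_integral_eq_zero (lin_memLp c).aemeasurable hz] at hv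
  rw [hv]
  refine Finset.sum_congr rfl fun a _ => ?_
  rw [variance_const_mul, variance_fun_id_gaussianReal]
  simp

lemma sp_obs {n d : ℕ} (lam : ℝ) (u v : Fin d → ℝ) (i : Fin n) (y : Fin n ⊕ Fin n × Fin d → ℝ) :
    sp u (obs lam v y) i = ∑ a, Sum.elim (fun i' => if i' = i then Real.sqrt lam * ∑ j, u j * v j else 0)
      (fun p : Fin n × Fin d => if p.1 = i then u p.2 else 0) a * y a := by
  rw [Fintype.sum_sum_type]
  simp only [Sum.elim_inl, Sum.elim_inr, ite_mul, zero_mul, Finset.sum_ite_eq', Finset.mem_univ,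
    if_true]
  rw [Fintype.sum_prod_type_right]
  simp only [Finset.sum_ite_eq', Finset.mem_univ, if_true, sp, obs, mul_add, Finset.sum_add_distrib]
  congr 1
  rw [Finset.mul_sum, Finset.sum_mul]
  exact Finset.sum_congr rfl fun j _ => by ring

lemma sp_integrable {n d : ℕ} (lam : ℝ) (u v : Fin d → ℝ) (i : Fin n) :
    Integrable (fun x => sp u x i ^ 2) (Law n lam v) := by
  rw [Law, integrable_map_measure ((measurable_sp u i).pow_const 2).aestronglyMeasurable
    (measurable_obs lam v).aemeasurable]
  simp only [Function.comp_def, sp_obs]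
  exact (lin_memLp _).integrable_sq

lemma sp_moment {n d : ℕ} (lam : ℝ) (hl : 0 < lam) (u v : Fin d → ℝ) (i : Fin n) :
    ∫ x, sp u x i ^ 2 ∂(Law n lam v) = lam * (∑ j, u j * v j) ^ 2 + ∑ j, u j ^ 2 := by
  rw [Law, integral_map (measurable_obs lam v).aemeasurable
    ((measurable_sp u i).pow_const 2).aestronglyMeasurable]
  simp only [sp_obs]
  rw [lin_moment, Fintype.sum_sum_type]
  simp only [Sum.elim_inl, Sum.elim_inr, ite_pow, ne_eq, OfNat.ofNat_ne_zero, not_false_eq_true,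
    zero_pow, Finset.sum_ite_eq', Finset.mem_univ, if_true]
  rw [Fintype.sum_prod_type_right]
  simp only [Finset.sum_ite_eq', Finset.mem_univ, if_true]
  rw [mul_pow, Real.sq_sqrt hl.le]

/-- log-likelihood ratio -/
def llr {n d : ℕ} (lam : ℝ) (v w : Fin d → ℝ) (x : Fin n × Fin d → ℝ) : ℝ :=
  ∑ i, lam / (2 * (1 + lam)) * (sp v x i ^ 2 - sp w x i ^ 2)

lemma dens_eq {n d : ℕ} (lam : ℝ) (v w : Fin d → ℝ) (x : Fin n × Fin d → ℝ) :
    dens lam v x = Real.exp (llr lam v w x) * dens lam w x := by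
  unfold dens llr
  rw [Real.exp_sum, ← Finset.prod_mul_distrib]
  refine Finset.prod_congr rfl fun i _ => ?_
  rw [mul_left_comm, ← Real.exp_add]
  congr 2
  ring

lemma llr_integrable {n d : ℕ} (lam : ℝ) (v w : Fin d → ℝ) :
    Integrable (llr (n := n) lam v w) (Law n lam v) := by
  unfold llr
  refine integrable_finsetSum _ fun i _ => ?_
  exact ((sp_integrable lam v v i).sub (sp_integrable lam w v i)).const_mul _

lemma llr_integral {n d : ℕ} (lam : ℝ) (hl : 0 < lam) (v w : Fin d → ℝ) (hv : ∑ j, v j ^ 2 = 1)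
    (hw : ∑ j, w j ^ 2 = 1) :
    ∫ x, llr (n := n) lam v w x ∂(Law n lam v) =
      n * (lam ^ 2 / (2 * (1 + lam)) * (1 - (∑ j, w j * v j) ^ 2)) := by
  unfold llr
  have hi : ∀ i ∈ (Finset.univ : Finset (Fin n)), Integrable
      (fun x => lam / (2 * (1 + lam)) * (sp v x i ^ 2 - sp w x i ^ 2)) (Law n lam v) := fun i _ =>
    ((sp_integrable lam v v i).sub (sp_integrable lam w v i)).const_mul _
  rw [integral_finsetSum _ hi]
  have : ∀ i : Fin n, ∫ x, lam / (2 * (1 + lam)) * (sp v x i ^ 2 - sp w x i ^ 2) ∂(Law n lam v) =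
      lam ^ 2 / (2 * (1 + lam)) * (1 - (∑ j, w j * v j) ^ 2) := by
    intro i
    rw [integral_const_mul, integral_sub (sp_integrable lam v v i) (sp_integrable lam w v i),
      sp_moment lam hl, sp_moment lam hl]
    have : ∑ j, v j * v j = 1 := by rw [← hv]; exact Finset.sum_congr rfl fun j _ => by ring
    rw [this, hv, hw]
    ring
  simp [this]

lemma test_bound {n d : ℕ} (lam : ℝ) (hl : 0 < lam) (v w : Fin d → ℝ) (hv : ∑ j, v j ^ 2 = 1)
    (hw : ∑ j, w j ^ 2 = 1) (t : ℝ) (ht : 0 < t) (K : ℝ)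
    (hK : n * (lam ^ 2 / (2 * (1 + lam)) * (1 - (∑ j, w j * v j) ^ 2)) ≤ K)
    (A : Set (Fin n × Fin d → ℝ)) (hA : MeasurableSet A) :
    (Law n lam v) A ≤ ENNReal.ofReal (Real.exp t) * (Law n lam w) A + ENNReal.ofReal ((K + 1) / t) := by
  have hml : Measurable (llr (n := n) lam v w) := by
    unfold llr
    refine Finset.measurable_sum _ fun i _ => ?_
    have := measurable_sp (n := n) v i
    have := measurable_sp (n := n) w i
    fun_prop
  set B : Set (Fin n × Fin d → ℝ) := {x | t ≤ llr lam v w x} with hB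
  have hBm : MeasurableSet B := measurableSet_le measurable_const hml
  have hdv : Measurable (fun x : Fin n × Fin d → ℝ => ENNReal.ofReal (dens lam v x)) :=
    (measurable_dens lam v).ennreal_ofReal
  have hdw : Measurable (fun x : Fin n × Fin d → ℝ => ENNReal.ofReal (dens lam w x)) :=
    (measurable_dens lam w).ennreal_ofReal
  have h1 : (Law n lam v) (A \ B) ≤ ENNReal.ofReal (Real.exp t) * (Law n lam w) A := by
    calc (Law n lam v) (A \ B) = ∫⁻ x in A \ B, ENNReal.ofReal (dens lam v x) ∂(Ref n d) := by
          rw [law_eq n lam hl v hv, withDensity_apply _ (hA.diff hBm)]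
      _ ≤ ∫⁻ x in A \ B, ENNReal.ofReal (Real.exp t) * ENNReal.ofReal (dens lam w x) ∂(Ref n d) := by
          refine setLIntegral_mono (hdw.const_mul _) fun x hx => ?_
          rw [← ENNReal.ofReal_mul (Real.exp_pos t).le]
          refine ENNReal.ofReal_le_ofReal ?_
          rw [dens_eq lam v w]
          have : llr lam v w x ≤ t := by
            have := hx.2
            simp only [hB, Set.mem_ofPred_eq, not_le] at this
            exact this.le
          exact mul_le_mul_of_nonneg_right (Real.exp_le_exp.2 this) (dens_pos lam hl w x).le
      _ = ENNReal.ofReal (Real.exp t) * (Law n lam w) (A \ B) := by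
          rw [lintegral_const_mul _ hdw, law_eq n lam hl w hw, withDensity_apply _ (hA.diff hBm)]
      _ ≤ _ := by gcongr; exact Set.sdiff_subset
  have hneg : ∫⁻ x, ENNReal.ofReal (-llr lam v w x) ∂(Law n lam v) ≤ 1 := by
    rw [law_eq n lam hl v hv, lintegral_withDensity_eq_lintegral_mul _ hdv (by fun_prop)]
    calc _ ≤ ∫⁻ x, ENNReal.ofReal (dens lam w x) ∂(Ref n d) := by
          refine lintegral_mono fun x => ?_
          simp only [Pi.mul_apply]
          rw [← ENNReal.ofReal_mul (dens_pos lam hl v x).le]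
          refine ENNReal.ofReal_le_ofReal ?_
          rw [dens_eq lam v w]
          have h2 := Real.add_one_le_exp (-llr lam v w x)
          have h3 : Real.exp (llr lam v w x) * Real.exp (-llr lam v w x) = 1 := by
            rw [← Real.exp_add]; simp
          have h4 := dens_pos lam hl w x
          have h5 := Real.exp_pos (llr lam v w x)
          have : Real.exp (llr lam v w x) * (-llr lam v w x) ≤ 1 := by nlinarith
          nlinarith
      _ = (Law n lam w) Set.univ := by
          rw [law_eq n lam hl w hw, withDensity_apply _ MeasurableSet.univ, Measure.restrict_univ]
      _ = 1 := measure_univ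
  have hint := integral_eq_lintegral_pos_part_sub_lintegral_neg_part (llr_integrable (n := n) lam v w)
  rw [llr_integral lam hl v w hv hw] at hint
  have hfin : ∫⁻ x, ENNReal.ofReal (llr lam v w x) ∂(Law n lam v) ≠ ⊤ := by
    refine ne_top_of_le_ne_top (llr_integrable (n := n) lam v w).2.ne ?_
    refine lintegral_mono fun x => ?_
    rw [← ofReal_norm]
    exact ENNReal.ofReal_le_ofReal (le_abs_self _)
  have hnr : (∫⁻ x, ENNReal.ofReal (-llr lam v w x) ∂(Law n lam v)).toReal ≤ 1 :=
    ENNReal.toReal_le_of_le_ofReal zero_le_one (by simpa using hneg)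
  have hpos : ∫⁻ x, ENNReal.ofReal (llr lam v w x) ∂(Law n lam v) ≤ ENNReal.ofReal (K + 1) := by
    rw [← ENNReal.ofReal_toReal hfin]
    exact ENNReal.ofReal_le_ofReal (by linarith)
  have h2 : (Law n lam v) B ≤ ENNReal.ofReal ((K + 1) / t) := by
    have hmk := mul_meas_ge_le_lintegral (μ := Law n lam v) hml.ennreal_ofReal (ENNReal.ofReal t)
    have hsub : B ⊆ {x | ENNReal.ofReal t ≤ ENNReal.ofReal (llr lam v w x)} := fun x hx =>
      ENNReal.ofReal_le_ofReal hx
    rw [ENNReal.ofReal_div_of_pos ht, ENNReal.le_div_iff_mul_le (by simp [ht]) (by simp), mul_comm]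
    exact (mul_le_mul_right (measure_mono hsub) _).trans (hmk.trans hpos)
  calc (Law n lam v) A ≤ (Law n lam v) ((A \ B) ∪ B) := measure_mono (by
        intro x hx; by_cases h : x ∈ B <;> simp [h, hx])
    _ ≤ _ := (measure_union_le _ _).trans (add_le_add h1 h2)

lemma avg_bound {ι X : Type*} [MeasurableSpace X] (S : Finset ι) (hS : S.Nonempty)
    (P : ι → Measure X) (Q : Measure X) [IsProbabilityMeasure Q] (A : ι → Set X)
    (hA : ∀ f, MeasurableSet (A f)) (e b N : ℝ) (he : 0 ≤ e) (hb : 0 ≤ b) (hN : 0 ≤ N)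
    (h : ∀ f ∈ S, P f (A f) ≤ ENNReal.ofReal e * Q (A f) + ENNReal.ofReal b)
    (hc : ∀ y, ∀ S' ⊆ S, (∀ f ∈ S', y ∈ A f) → (S'.card : ℝ) ≤ N)
    (hfin : e * N + S.card * b ≤ 3 / 4 * S.card) :
    ∃ f ∈ S, P f (A f) ≤ ENNReal.ofReal (3 / 4) := by
  classical
  by_contra hcon
  push Not at hcon
  have h1 : ∑ f ∈ S, Q (A f) ≤ ENNReal.ofReal N := by
    calc ∑ f ∈ S, Q (A f) = ∑ f ∈ S, ∫⁻ y, (A f).indicator 1 y ∂Q :=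
          Finset.sum_congr rfl fun f _ => (lintegral_indicator_one (hA f)).symm
      _ = ∫⁻ y, ∑ f ∈ S, (A f).indicator 1 y ∂Q :=
          (lintegral_finsetSum _ fun f _ => measurable_one.indicator (hA f)).symm
      _ ≤ ∫⁻ _, ENNReal.ofReal N ∂Q := by
          refine lintegral_mono fun y => ?_
          have : ∑ f ∈ S, (A f).indicator (1 : X → ENNReal) y = ((S.filter fun f => y ∈ A f).card : ENNReal) := by
            simp [Set.indicator_apply]
          rw [this, ← ENNReal.ofReal_natCast]
          exact ENNReal.ofReal_le_ofReal (hc y _ (Finset.filter_subset _ _)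
            fun f hf => (Finset.mem_filter.1 hf).2)
      _ = ENNReal.ofReal N := by simp
  have h2 : ∑ f ∈ S, ENNReal.ofReal (3 / 4) < ∑ f ∈ S, P f (A f) := by
    refine ENNReal.sum_lt_sum_of_nonempty hS hcon
  have h3 : ∑ f ∈ S, P f (A f) ≤ ENNReal.ofReal (3 / 4 * S.card) := by
    calc ∑ f ∈ S, P f (A f) ≤ ∑ f ∈ S, (ENNReal.ofReal e * Q (A f) + ENNReal.ofReal b) :=
          Finset.sum_le_sum h
      _ = ENNReal.ofReal e * ∑ f ∈ S, Q (A f) + S.card * ENNReal.ofReal b := by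
          rw [Finset.sum_add_distrib, Finset.mul_sum]; simp
      _ ≤ ENNReal.ofReal e * ENNReal.ofReal N + S.card * ENNReal.ofReal b := by gcongr
      _ = ENNReal.ofReal (e * N + S.card * b) := by
          rw [ENNReal.ofReal_add (by positivity) (by positivity), ENNReal.ofReal_mul he,
            ENNReal.ofReal_mul (by positivity), ENNReal.ofReal_natCast]
      _ ≤ _ := ENNReal.ofReal_le_ofReal hfin
  refine absurd (h2.trans_le h3) (not_lt.2 ?_)
  rw [Finset.sum_const, nsmul_eq_mul, mul_comm, ENNReal.ofReal_mul (by norm_num),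
    ENNReal.ofReal_natCast]

lemma ball_count {d k m : ℕ} (V : Fin k → Finset (Fin d)) (hV : ∀ j, (V j).card = m) (hm : 1 ≤ m)
    (g : Fin k → Fin d) (S : Finset (Fin k → Fin d)) (hS : S ⊆ Fintype.piFinset V)
    (hd : ∀ f ∈ S, ((Finset.univ.filter fun j => ¬ f j = g j).card : ℝ) ≤ k / 4) :
    (S.card : ℝ) ≤ 2 ^ k * Real.exp (k / 4 * Real.log m) := by
  have hm0 : (0 : ℝ) < m := by exact_mod_cast hm
  have hlog : 0 ≤ Real.log m := Real.log_nonneg (by exact_mod_cast hm)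
  have h1 : ∑ f ∈ Fintype.piFinset V, ∏ j, (if f j = g j then (1 : ℝ) else (m : ℝ)⁻¹) ≤ 2 ^ k := by
    have hps := (Finset.prod_univ_sum V (fun j x => if x = g j then (1 : ℝ) else (m : ℝ)⁻¹)).symm
    rw [hps]
    calc _ ≤ ∏ _j : Fin k, (2 : ℝ) := by
          refine Finset.prod_le_prod (fun j _ => Finset.sum_nonneg fun x _ => by positivity) fun j _ => ?_
          calc _ ≤ ∑ x ∈ V j, ((if x = g j then (1 : ℝ) else 0) + (m : ℝ)⁻¹) := by
                refine Finset.sum_le_sum fun x _ => ?_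
                have : 0 < (m : ℝ)⁻¹ := by positivity
                split_ifs <;> linarith
            _ ≤ 1 + 1 := by
                rw [Finset.sum_add_distrib]
                refine add_le_add ?_ ?_
                · rw [Finset.sum_ite_eq']; split_ifs <;> norm_num
                · rw [Finset.sum_const, hV, nsmul_eq_mul, mul_inv_cancel₀ hm0.ne']
            _ = 2 := by norm_num
      _ = 2 ^ k := by simp
  have h2 : ∀ f ∈ S, Real.exp (-(k / 4 * Real.log m)) ≤ ∏ j, (if f j = g j then (1 : ℝ) else (m : ℝ)⁻¹) := by
    intro f hf
    rw [Finset.prod_ite, Finset.prod_const_one, one_mul, Finset.prod_const]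
    have e1 : (m : ℝ)⁻¹ = Real.exp (-Real.log m) := by rw [Real.exp_neg, Real.exp_log hm0]
    rw [e1, ← Real.exp_nat_mul]
    refine Real.exp_le_exp.2 ?_
    have := hd f hf
    nlinarith
  have h3 : (S.card : ℝ) * Real.exp (-(k / 4 * Real.log m)) ≤ 2 ^ k := by
    calc _ = ∑ f ∈ S, Real.exp (-(k / 4 * Real.log m)) := by simp
      _ ≤ ∑ f ∈ S, ∏ j, (if f j = g j then (1 : ℝ) else (m : ℝ)⁻¹) := Finset.sum_le_sum h2
      _ ≤ _ := Finset.sum_le_sum_of_subset_of_nonneg hS fun f _ _ =>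
          Finset.prod_nonneg fun j _ => by positivity
      _ ≤ _ := h1
  rw [Real.exp_neg] at h3
  have := Real.exp_pos (k / 4 * Real.log m)
  rw [← div_eq_mul_inv, div_le_iff₀ this] at h3
  exact h3

/-- hypothesis vector -/
def hyp {d k : ℕ} (G : LayeredGraph d k) (ε : ℝ) (f : Fin k → Fin d) : Fin d → ℝ := fun i =>
  Real.sqrt (1 - ε ^ 2) * (if i = G.vs then 1 else 0) +
    ε / Real.sqrt k * ∑ j, (if i = f j then 1 else 0)

lemma hyp_sum {d k : ℕ} (G : LayeredGraph d k) (ε : ℝ) (f : Fin k → Fin d) (w : Fin d → ℝ) :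
    ∑ i, hyp G ε f i * w i = Real.sqrt (1 - ε ^ 2) * w G.vs + ε / Real.sqrt k * ∑ j, w (f j) := by
  simp only [hyp, add_mul, Finset.sum_add_distrib, mul_assoc, ← Finset.mul_sum, Finset.sum_mul]
  rw [Finset.sum_comm]
  simp

lemma hyp_vs {d k : ℕ} (G : LayeredGraph d k) (ε : ℝ) (f : Fin k → Fin d)
    (hf : f ∈ Fintype.piFinset G.V) : hyp G ε f G.vs = Real.sqrt (1 - ε ^ 2) := by
  have : ∀ j, ¬ G.vs = f j := fun j h => G.hvs j (h ▸ Fintype.mem_piFinset.1 hf j)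
  simp [hyp, this]

lemma hyp_layer {d k : ℕ} (G : LayeredGraph d k) (ε : ℝ) (f g : Fin k → Fin d)
    (hf : f ∈ Fintype.piFinset G.V) (hg : g ∈ Fintype.piFinset G.V) (j : Fin k) :
    hyp G ε g (f j) = ε / Real.sqrt k * (if f j = g j then 1 else 0) := by
  have h1 : ¬ f j = G.vs := fun h => G.hvs j (h ▸ Fintype.mem_piFinset.1 hf j)
  have h2 : ∀ j', j' ≠ j → ¬ f j = g j' := fun j' hj h =>
    (Finset.disjoint_left.1 (G.hdisj j' j hj)) (Fintype.mem_piFinset.1 hg j')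
      (h ▸ Fintype.mem_piFinset.1 hf j)
  simp only [hyp, h1, if_false, mul_zero, zero_add]
  congr 1
  exact Finset.sum_eq_single j (fun j' _ hj => by simp [h2 j' hj]) (by simp)

lemma hyp_inner {d k : ℕ} (G : LayeredGraph d k) (hk : 0 < k) (ε : ℝ) (he : 0 ≤ ε) (he1 : ε ≤ 1)
    (f g : Fin k → Fin d)
    (hf : f ∈ Fintype.piFinset G.V) (hg : g ∈ Fintype.piFinset G.V) :
    ∑ i, hyp G ε f i * hyp G ε g i =
      1 - ε ^ 2 * ((Finset.univ.filter fun j => ¬ f j = g j).card / k) := by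
  rw [hyp_sum, hyp_vs G ε g hg, Real.mul_self_sqrt (by nlinarith)]
  simp only [hyp_layer G ε f g hf hg]
  rw [← Finset.mul_sum, ← mul_assoc, Finset.sum_boole]
  have hk' : (0 : ℝ) < k := by exact_mod_cast hk
  have h1 : ε / Real.sqrt k * (ε / Real.sqrt k) = ε ^ 2 / k := by
    rw [div_mul_div_comm, Real.mul_self_sqrt hk'.le]; ring
  rw [h1]
  have h2 := Finset.card_filter_add_card_filter_not (s := (Finset.univ : Finset (Fin k))) (fun j => f j = g j)
  rw [Finset.card_univ, Fintype.card_fin] at h2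
  have h3 : ((Finset.univ.filter fun j => f j = g j).card : ℝ) = k - (Finset.univ.filter fun j => ¬ f j = g j).card := by
    have h4 : (((Finset.univ.filter fun j => f j = g j).card +
        (Finset.univ.filter fun j => ¬ f j = g j).card : ℕ) : ℝ) = k := by rw [h2]
    push_cast at h4
    linarith
  rw [h3]
  field_simp
  ring

lemma hyp_norm {d k : ℕ} (G : LayeredGraph d k) (hk : 0 < k) (ε : ℝ) (he : 0 ≤ ε) (he1 : ε ≤ 1)
    (f : Fin k → Fin d) (hf : f ∈ Fintype.piFinset G.V) : ∑ i, hyp G ε f i ^ 2 = 1 := by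
  have := hyp_inner G hk ε he he1 f f hf hf
  simp only [not_true_eq_false, Finset.filter_false, Finset.card_empty] at this
  simpa [pow_two] using this

lemma hyp_sparse {d k : ℕ} (G : LayeredGraph d k) (ε : ℝ)
    (f : Fin k → Fin d) (hf : f ∈ Fintype.piFinset G.V) : G.PathSparse (hyp G ε f) := by
  refine ⟨{G.vs, G.vt} ∪ Finset.univ.image f, ⟨by simp, by simp, fun j => ?_⟩, fun i hi => ?_⟩
  · rw [Finset.card_eq_one]
    refine ⟨f j, ?_⟩
    ext i
    simp only [Finset.mem_inter, Finset.mem_union, Finset.mem_insert, Finset.mem_singleton,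
      Finset.mem_image, Finset.mem_univ, true_and]
    constructor
    · rintro ⟨(h | h) | ⟨j', h⟩, hV⟩
      · exact absurd (h ▸ hV) (G.hvs j)
      · exact absurd (h ▸ hV) (G.hvt j)
      · by_cases hj : j' = j
        · rw [← h, hj]
        · exact absurd (h ▸ hV)
            (Finset.disjoint_left.1 (G.hdisj j' j hj) (Fintype.mem_piFinset.1 hf j'))
    · rintro rfl
      exact ⟨Or.inr ⟨j, rfl⟩, Fintype.mem_piFinset.1 hf j⟩
  · by_contra hcon
    simp only [Finset.mem_union, Finset.mem_insert, Finset.mem_singleton,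
      Finset.mem_image, Finset.mem_univ, true_and, not_or, not_exists] at hcon
    apply hi
    have : ∀ j, ¬ i = f j := fun j h => hcon.2 j h.symm
    simp [hyp, hcon.1.1, this]

lemma frob_sq {d : ℕ} (A : Matrix (Fin d) (Fin d) ℝ) : frob A ^ 2 = ∑ i, ∑ j, A i j ^ 2 :=
  Real.sq_sqrt (Finset.sum_nonneg fun _ _ => Finset.sum_nonneg fun _ _ => sq_nonneg _)

lemma frob_nonneg {d : ℕ} (A : Matrix (Fin d) (Fin d) ℝ) : 0 ≤ frob A := Real.sqrt_nonneg _

lemma frob_unit {d : ℕ} (v w : Fin d → ℝ) (hv : ∑ j, v j ^ 2 = 1) (hw : ∑ j, w j ^ 2 = 1) :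
    frob (vecMulVec v v - vecMulVec w w) ^ 2 = 2 * (1 - (∑ i, v i * w i) ^ 2) := by
  rw [frob_sq]
  have : ∀ i j, (vecMulVec v v - vecMulVec w w) i j ^ 2 =
      v i ^ 2 * v j ^ 2 - 2 * ((v i * w i) * (v j * w j)) + w i ^ 2 * w j ^ 2 := by
    intro i j
    simp only [Matrix.sub_apply, vecMulVec_apply]; ring
  simp only [this, Finset.sum_add_distrib, Finset.sum_sub_distrib, ← Finset.mul_sum,
    ← Finset.sum_mul, hv, hw]
  ring

lemma frob_tri {d : ℕ} (A B C : Matrix (Fin d) (Fin d) ℝ) :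
    frob (A - B) ^ 2 ≤ 2 * frob (C - A) ^ 2 + 2 * frob (C - B) ^ 2 := by
  simp only [frob_sq, Finset.mul_sum, ← Finset.sum_add_distrib]
  refine Finset.sum_le_sum fun i _ => Finset.sum_le_sum fun j _ => ?_
  simp only [Matrix.sub_apply]
  nlinarith [sq_nonneg ((C i j - A i j) + (C i j - B i j))]

lemma log_four_le (m : ℕ) (hm : 63 ≤ m) : 4 ≤ Real.log m := by
  have hm' : (63 : ℝ) ≤ m := by exact_mod_cast hm
  rw [Real.le_log_iff_exp_le (by linarith)]
  have h1 := Real.exp_one_lt_d9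
  have h2 : Real.exp 4 = Real.exp 1 ^ 4 := by rw [← Real.exp_nat_mul]; norm_num
  rw [h2]
  calc Real.exp 1 ^ 4 ≤ (2.7182818286 : ℝ) ^ 4 := by
        gcongr
    _ ≤ 63 := by norm_num
    _ ≤ m := hm'

lemma size_facts {d k m : ℕ} (hd : 16 * k ^ 2 ≤ d) (hk : 4 ≤ k) (hmk : m * k = d - 2) :
    63 ≤ m ∧ Real.log d / 2 - Real.log k ≤ Real.log m := by
  have hk2 : 4 * k ≤ k ^ 2 := by nlinarith
  have hd2 : 256 ≤ d := by nlinarith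
  have hmk' : m * k + 2 = d := by omega
  have hm : 63 ≤ m := by
    by_contra h
    have : m ≤ 62 := by omega
    have : m * k ≤ 62 * k := Nat.mul_le_mul_right k this
    omega
  refine ⟨hm, ?_⟩
  have hdr : (256 : ℝ) ≤ d := by exact_mod_cast hd2
  have hkr : (4 : ℝ) ≤ k := by exact_mod_cast hk
  have hmr : (63 : ℝ) ≤ m := by exact_mod_cast hm
  have h1 : (m : ℝ) * k + 2 = d := by exact_mod_cast hmk'
  have h2 : Real.log d ≤ 2 * (Real.log m + Real.log k) := by
    rw [← Real.log_mul (by positivity) (by positivity), ← Real.log_rpow (by positivity)]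
    refine Real.log_le_log (by linarith) ?_
    norm_num
    nlinarith
  linarith

lemma num_fact {k m : ℕ} (hk : 4 ≤ k) (hm : 63 ≤ m) :
    Real.exp (k / 4 * Real.log m) * (2 ^ k * Real.exp (k / 4 * Real.log m)) +
      ((m ^ k : ℕ) : ℝ) * ((k / 16 * Real.log m + 1) / (k / 4 * Real.log m)) ≤
      3 / 4 * ((m ^ k : ℕ) : ℝ) := by
  have hL := log_four_le m hm
  have hkr : (4 : ℝ) ≤ k := by exact_mod_cast hk
  have hmr : (63 : ℝ) ≤ m := by exact_mod_cast hm
  have hmp : (0 : ℝ) < m := by linarith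
  set L := Real.log m with hLdef
  have hN : ((m ^ k : ℕ) : ℝ) = Real.exp (k * L) := by
    rw [Real.exp_nat_mul, hLdef, Real.exp_log hmp]; push_cast; rfl
  have hkL : 4 ≤ k / 4 * L := by nlinarith
  have hb : (k / 16 * L + 1) / (k / 4 * L) ≤ 1 / 2 := by
    rw [div_le_iff₀ (by linarith)]; linarith
  have h2 : (2 : ℝ) ^ k ≤ Real.exp (k * 1) := by
    rw [Real.exp_nat_mul]
    have := Real.exp_one_gt_d9
    gcongr
    linarith
  have h3 : Real.exp (k / 4 * L) * (2 ^ k * Real.exp (k / 4 * L)) ≤ 1 / 4 * Real.exp (k * L) := by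
    calc _ ≤ Real.exp (k / 4 * L) * (Real.exp (k * 1) * Real.exp (k / 4 * L)) := by gcongr
      _ = Real.exp (k / 4 * L + (k * 1 + k / 4 * L)) := by rw [Real.exp_add, Real.exp_add]
      _ ≤ Real.exp (k * L - 4) := by
          refine Real.exp_le_exp.2 ?_
          nlinarith
      _ = Real.exp (-4) * Real.exp (k * L) := by rw [← Real.exp_add]; ring_nf
      _ ≤ 1 / 4 * Real.exp (k * L) := by
          gcongr
          rw [Real.exp_neg]
          have := Real.add_one_le_exp (4 : ℝ)
          rw [inv_le_comm₀ (Real.exp_pos _) (by norm_num)]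
          linarith
  rw [hN]
  have := Real.exp_pos (k * L)
  nlinarith

lemma dist_arith (ε q a b : ℝ) (he : 0 < ε) (he1 : ε ≤ 1) (hq0 : 0 ≤ q) (hq1 : q ≤ 1)
    (ha0 : 0 ≤ a) (hb0 : 0 ≤ b) (ha : a < ε / 4) (hb : b < ε / 4)
    (h : 2 * (1 - (1 - ε ^ 2 * q) ^ 2) ≤ 2 * a ^ 2 + 2 * b ^ 2) : q ≤ 1 / 8 := by
  have he2 : ε ^ 2 ≤ 1 := pow_le_one₀ he.le he1
  have he20 : 0 < ε ^ 2 := by positivity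
  have h1 : a ^ 2 ≤ (ε / 4) ^ 2 := pow_le_pow_left₀ ha0 ha.le 2
  have h2 : b ^ 2 ≤ (ε / 4) ^ 2 := pow_le_pow_left₀ hb0 hb.le 2
  have h3 : 0 ≤ ε ^ 2 * q := by positivity
  have h4 : ε ^ 2 * q ≤ 1 := mul_le_one₀ he2 hq0 hq1
  have h5 : ε ^ 2 * q ≤ ε ^ 2 * (1 / 8) := by
    generalize ε ^ 2 * q = r at *
    nlinarith
  exact le_of_mul_le_mul_left h5 he20

/-- Corollary 1(b): minimax lower bound for path-sparse PCA. -/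
theorem minimax_lower_bound_path_sparse :
    ∃ c : ℝ, 0 < c ∧
      ∀ (d k n : ℕ) (G : LayeredGraph d k),
        16 * k ^ 2 ≤ d → 4 ≤ k → 1 ≤ n →
        ∀ lam : ℝ, 0 < lam →
        ∀ vhat : (Fin n → Fin d → ℝ) → Fin d → ℝ, Measurable vhat →
        ∃ vstar : Fin d → ℝ, G.PathSparse vstar ∧ nrm vstar = 1 ∧
          ∀ (Ω : Type) (_ : MeasurableSpace Ω) (μ : Measure Ω), IsProbabilityMeasure μ →
            ∀ x : Fin n → Ω → Fin d → ℝ, IsSpikedWishart μ lam vstar x →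
              ENNReal.ofReal (c *
                min 1 (Real.sqrt ((1 + lam) / (8 * lam ^ 2)) *
                  Real.sqrt ((k * (Real.log d / 2 - Real.log k)) / n)))
              ≤ ∫⁻ ω, ENNReal.ofReal
                  (frob (vecMulVec (vhat fun i => x i ω) (vhat fun i => x i ω) -
                    vecMulVec vstar vstar)) ∂μ := by
  refine ⟨1 / 16, by norm_num, ?_⟩
  intro d k n G hd hk hn lam hl vhat hvhat
  set Lk := Real.log d / 2 - Real.log k with hLk
  set ε := min 1 (Real.sqrt ((1 + lam) / (8 * lam ^ 2)) * Real.sqrt ((k * Lk) / n)) with hε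
  obtain ⟨m, hm⟩ : ∃ m, m = (d - 2) / k := ⟨_, rfl⟩
  have hmk : m * k = d - 2 := by rw [hm]; exact Nat.div_mul_cancel G.hdvd
  have hV : ∀ j, (G.V j).card = m := fun j => by rw [G.hcard j, hm]
  obtain ⟨hm63, hLm⟩ := size_facts hd hk hmk
  have hk0 : 0 < k := by omega
  have hkr : (4 : ℝ) ≤ k := by exact_mod_cast hk
  have hnr : (1 : ℝ) ≤ n := by exact_mod_cast hn
  have hL4 := log_four_le m hm63
  have he1 : ε ≤ 1 := min_le_left _ _
  have hLpos : 0 < Lk := by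
    have h1 : (16 : ℝ) * k ^ 2 ≤ d := by exact_mod_cast hd
    have h2 := Real.log_le_log (by positivity) h1
    rw [Real.log_mul (by norm_num) (by positivity), Real.log_pow] at h2
    have h3 : 0 < Real.log 16 := Real.log_pos (by norm_num)
    push_cast at h2
    rw [hLk]
    linarith
  have hepos : 0 < ε := lt_min one_pos (by positivity)
  have hesq : ε ^ 2 ≤ (1 + lam) / (8 * lam ^ 2) * ((k * Lk) / n) := by
    have h1 : ε ≤ Real.sqrt ((1 + lam) / (8 * lam ^ 2)) * Real.sqrt ((k * Lk) / n) := min_le_right _ _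
    calc ε ^ 2 ≤ (Real.sqrt ((1 + lam) / (8 * lam ^ 2)) * Real.sqrt ((k * Lk) / n)) ^ 2 := by gcongr
      _ = _ := by rw [mul_pow, Real.sq_sqrt (by positivity), Real.sq_sqrt (by positivity)]
  set S := Fintype.piFinset G.V with hS
  have hScard : S.card = m ^ k := by rw [hS, Fintype.card_piFinset]; simp [hV]
  have hSne : S.Nonempty := by
    rw [← Finset.card_pos, hScard]; positivity
  set w : Fin d → ℝ := fun i => if i = G.vs then 1 else 0 with hw
  have hwn : ∑ i, w i ^ 2 = 1 := by simp [hw]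
  have hwi : ∀ f ∈ S, (∑ i, w i * hyp G ε f i) ^ 2 = 1 - ε ^ 2 := by
    intro f hf
    have : ∑ i, w i * hyp G ε f i = hyp G ε f G.vs := by simp [hw]
    rw [this, hyp_vs G ε f hf, Real.sq_sqrt (by nlinarith)]
  have hfm : ∀ f, Measurable (fun y : Fin n → Fin d → ℝ =>
      frob (vecMulVec (vhat y) (vhat y) - vecMulVec (hyp G ε f) (hyp G ε f))) := by
    intro f
    unfold frob
    refine Measurable.sqrt ?_
    simp only [Matrix.sub_apply, vecMulVec_apply]
    fun_prop
  let lossf : (Fin k → Fin d) → (Fin n × Fin d → ℝ) → ℝ := fun f y =>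
    frob (vecMulVec (vhat fun i j => y (i, j)) (vhat fun i j => y (i, j)) -
      vecMulVec (hyp G ε f) (hyp G ε f))
  have hlm : ∀ f, Measurable (lossf f) := fun f => (hfm f).comp (by fun_prop)
  let A : (Fin k → Fin d) → Set (Fin n × Fin d → ℝ) := fun f => {y | lossf f y < ε / 4}
  have hAm : ∀ f, MeasurableSet (A f) := fun f => measurableSet_lt (hlm f) measurable_const
  obtain ⟨f, hf, hPf⟩ := avg_bound S hSne (fun f => Law n lam (hyp G ε f)) (Law n lam w) A hAm
    (Real.exp (k / 4 * Real.log m)) ((k / 16 * Real.log m + 1) / (k / 4 * Real.log m))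
    (2 ^ k * Real.exp (k / 4 * Real.log m)) (by positivity) (by positivity) (by positivity)
    (by
      intro f hf
      refine test_bound lam hl (hyp G ε f) w (hyp_norm G hk0 ε hepos.le he1 f hf) hwn _
        (by positivity) _ ?_ _ (hAm f)
      rw [hwi f hf]
      calc (n : ℝ) * (lam ^ 2 / (2 * (1 + lam)) * (1 - (1 - ε ^ 2)))
          = n * (lam ^ 2 / (2 * (1 + lam))) * ε ^ 2 := by ring
        _ ≤ n * (lam ^ 2 / (2 * (1 + lam))) * ((1 + lam) / (8 * lam ^ 2) * ((k * Lk) / n)) := by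
            gcongr
        _ = k / 16 * Lk := by field_simp; norm_num
        _ ≤ k / 16 * Real.log m := by gcongr)
    (by
      intro y S' hS' hy
      rcases S'.eq_empty_or_nonempty with rfl | ⟨g, hg⟩
      · simp only [Finset.card_empty, Nat.cast_zero]; positivity
      · refine ball_count G.V hV (by omega) g S' hS' fun f hf => ?_
        have hf1 : lossf f y < ε / 4 := hy f hf
        have hg1 : lossf g y < ε / 4 := hy g hg
        have hf0 : 0 ≤ lossf f y := frob_nonneg _
        have hg0 : 0 ≤ lossf g y := frob_nonneg _
        have ht := frob_tri (vecMulVec (hyp G ε f) (hyp G ε f)) (vecMulVec (hyp G ε g) (hyp G ε g))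
          (vecMulVec (vhat fun i j => y (i, j)) (vhat fun i j => y (i, j)))
        rw [frob_unit _ _ (hyp_norm G hk0 ε hepos.le he1 f (hS' hf))
          (hyp_norm G hk0 ε hepos.le he1 g (hS' hg)),
          hyp_inner G hk0 ε hepos.le he1 f g (hS' hf) (hS' hg)] at ht
        change _ ≤ 2 * lossf f y ^ 2 + 2 * lossf g y ^ 2 at ht
        set D : ℝ := ((Finset.univ.filter fun j => ¬ f j = g j).card : ℝ) with hD
        have hDk : D ≤ k := by
          rw [hD]
          have := Finset.card_le_univ (Finset.univ.filter fun j => ¬ f j = g j)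
          rw [Fintype.card_fin] at this
          exact_mod_cast this
        have hD0 : 0 ≤ D := Nat.cast_nonneg _
        have hq0 : 0 ≤ D / k := by positivity
        have hq1 : D / k ≤ 1 := by rw [div_le_one (by linarith)]; exact hDk
        set q := D / k with hq
        have h6 : q ≤ 1 / 8 := dist_arith ε q _ _ hepos he1 hq0 hq1 hf0 hg0 hf1 hg1 ht
        rw [hq, div_le_iff₀ (by linarith)] at h6
        linarith)
    (by rw [hScard]; exact num_fact hk hm63)
  refine ⟨hyp G ε f, hyp_sparse G ε f hf, ?_, ?_⟩
  · rw [nrm, hyp_norm G hk0 ε hepos.le he1 f hf, Real.sqrt_one]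
  intro Ω _ μ hμ x hx
  rw [law_apply μ lam (hyp G ε f) x hx (fun y => ENNReal.ofReal
    (frob (vecMulVec (vhat y) (vhat y) - vecMulVec (hyp G ε f) (hyp G ε f)))) (hfm f).ennreal_ofReal]
  have hcompl : ENNReal.ofReal (1 / 4) ≤ (Law n lam (hyp G ε f)) (A f)ᶜ := by
    rw [prob_compl_eq_one_sub (hAm f)]
    have : ENNReal.ofReal (1 / 4) = 1 - ENNReal.ofReal (3 / 4) := by
      rw [← ENNReal.ofReal_one, ← ENNReal.ofReal_sub _ (by norm_num)]
      norm_num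
    rw [this]
    exact tsub_le_tsub_left hPf 1
  have hmk := mul_meas_ge_le_lintegral (μ := Law n lam (hyp G ε f)) (hlm f).ennreal_ofReal
    (ENNReal.ofReal (ε / 4))
  have hsub : (A f)ᶜ ⊆ {y | ENNReal.ofReal (ε / 4) ≤ ENNReal.ofReal (lossf f y)} := by
    intro y hy
    have : ¬ lossf f y < ε / 4 := hy
    exact ENNReal.ofReal_le_ofReal (not_lt.1 this)
  calc ENNReal.ofReal (1 / 16 * ε) = ENNReal.ofReal (ε / 4) * ENNReal.ofReal (1 / 4) := by
        rw [← ENNReal.ofReal_mul (by positivity)]; congr 1; ring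
    _ ≤ ENNReal.ofReal (ε / 4) * (Law n lam (hyp G ε f)) (A f)ᶜ := by gcongr
    _ ≤ ENNReal.ofReal (ε / 4) * (Law n lam (hyp G ε f))
          {y | ENNReal.ofReal (ε / 4) ≤ ENNReal.ofReal (lossf f y)} := by gcongr
    _ ≤ _ := hmk

end StructuredPCA
end
end

section
/- There exist universal positive constants (c, C₁, C₂, C₃) such that the following holds. Let v* ∈ S^{d−1} be k-path-sparse, let λ ≥ C₁ and n ≥ C₂ k ln d, let x_1, …, x_n be spiked Wishart samples with spike v* and sample covariance Σ̂, and consider the projected power iterates over 𝓜_P starting from v_0 ∈ 𝓜_P ∩ S^{d−1} with ⟨v_0, v*⟩ ≥ 1/2. Then with probability at least 1 − exp(−ck), simultaneously for all t ≥ 1, ‖v_t − v*‖₂ ≤ 2^{−t} · ‖v_0 − v*‖₂ + C₃ · √( k(2 ln d − ln k) / n ). -/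
open MeasureTheory ProbabilityTheory Matrix Finset

noncomputable section

namespace StructuredPCA

lemma aux_exp_ineq (x : ℝ) (hx : |x| ≤ 1 / 2) : Real.exp (-x - x ^ 2) ≤ 1 - x := by
  have h1 := abs_le.1 hx
  have key : 1 ≤ Real.exp (x + x ^ 2) * (1 - x) := by
    rcases le_total x 0 with h | h
    · have := Real.add_one_le_exp (x + x ^ 2)
      have h3 : x ^ 3 ≤ 0 := by
        have : x ^ 3 = x * x ^ 2 := by ring
        rw [this]; exact mul_nonpos_of_nonpos_of_nonneg h (sq_nonneg x)
      nlinarith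
    · have := Real.quadratic_le_exp_of_nonneg (x := x + x ^ 2) (by positivity)
      have h2 : (1 + (x + x ^ 2) + (x + x ^ 2) ^ 2 / 2) * (1 - x) ≤ Real.exp (x + x ^ 2) * (1 - x) :=
        mul_le_mul_of_nonneg_right this (by linarith)
      have h3 : 0 ≤ x ^ 2 * ((1 + x) ^ 2 * (1 - x) / 2 - x) := by
        apply mul_nonneg (sq_nonneg x)
        nlinarith [mul_nonneg h (by linarith : (0:ℝ) ≤ 1 / 2 - x), mul_nonneg h h, mul_nonneg (mul_nonneg h h) (by linarith : (0:ℝ) ≤ 1 / 2 - x)]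
      nlinarith
  have h4 : Real.exp (-x - x ^ 2) * Real.exp (x + x ^ 2) = 1 := by
    rw [← Real.exp_add]; simp
  have h5 := Real.exp_pos (-x - x ^ 2)
  calc Real.exp (-x - x ^ 2) = Real.exp (-x - x ^ 2) * 1 := by ring
    _ ≤ Real.exp (-x - x ^ 2) * (Real.exp (x + x ^ 2) * (1 - x)) := by gcongr
    _ = 1 - x := by rw [← mul_assoc, h4, one_mul]

lemma integral_exp_sq_gaussian (s : ℝ) (hs : s < 1 / 2) :
    ∫ x, Real.exp (s * (x ^ 2 - 1)) ∂(gaussianReal 0 1) = Real.exp (-s) / √(1 - 2 * s) := by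
  rw [integral_gaussianReal_eq_integral_smul (by simp)]
  have : ∀ x : ℝ, gaussianPDFReal 0 1 x • Real.exp (s * (x ^ 2 - 1)) =
      ((√(2 * Real.pi))⁻¹ * Real.exp (-s)) * Real.exp (-(1 / 2 - s) * x ^ 2) := by
    intro x
    simp only [gaussianPDFReal, smul_eq_mul, NNReal.coe_one, mul_one, sub_zero]
    rw [mul_assoc, mul_assoc, ← Real.exp_add, ← Real.exp_add]
    congr 2; ring
  simp_rw [this]
  rw [integral_const_mul, integral_gaussian]
  have e : Real.pi / (1 / 2 - s) = (2 * Real.pi) / (1 - 2 * s) := by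
    rw [div_eq_div_iff (by linarith) (by linarith)]; ring
  rw [e, Real.sqrt_div (by positivity)]
  have : √(2 * Real.pi) ≠ 0 := by positivity
  field_simp

lemma chi_mgf {Ω : Type*} [MeasurableSpace Ω] {μ : Measure Ω} {Y : Ω → ℝ}
    (hY : AEMeasurable Y μ) (hl : μ.map Y = gaussianReal 0 1) (s : ℝ) (hs : |s| ≤ 1 / 4) :
    0 < mgf (fun ω => Y ω ^ 2 - 1) μ s ∧ mgf (fun ω => Y ω ^ 2 - 1) μ s ≤ Real.exp (2 * s ^ 2) := by
  have hs' := abs_le.1 hs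
  have : mgf (fun ω => Y ω ^ 2 - 1) μ s = Real.exp (-s) / √(1 - 2 * s) := by
    rw [← integral_exp_sq_gaussian s (by linarith), ← hl, integral_map hY]
    · rfl
    · exact Continuous.aestronglyMeasurable (by fun_prop)
  rw [this]
  have hp : 0 < 1 - 2 * s := by linarith
  have hq : 0 < √(1 - 2 * s) := Real.sqrt_pos.2 hp
  refine ⟨by positivity, ?_⟩
  rw [div_le_iff₀ hq]
  have h := aux_exp_ineq (2 * s) (by rw [abs_mul, abs_two]; linarith)
  have h2 : Real.exp (-s - 2 * s ^ 2) ≤ √(1 - 2 * s) := by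
    apply Real.le_sqrt_of_sq_le
    rw [← Real.exp_nat_mul]
    convert h using 2
    push_cast; ring
  calc Real.exp (-s) = Real.exp (2 * s ^ 2) * Real.exp (-s - 2 * s ^ 2) := by
        rw [← Real.exp_add]; congr 1; ring
    _ ≤ _ := by gcongr

lemma chi_tail {Ω : Type*} [MeasurableSpace Ω] {μ : Measure Ω} [IsProbabilityMeasure μ] {n : ℕ}
    {Y : Fin n → Ω → ℝ} (hY : ∀ i, Measurable (Y i)) (hind : iIndepFun Y μ)
    (hl : ∀ i, μ.map (Y i) = gaussianReal 0 1) (t : ℝ) (ht : 0 ≤ t) (ht1 : t ≤ 1) :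
    μ.real {ω | n * t ≤ |∑ i, (Y i ω ^ 2 - 1)|} ≤ 2 * Real.exp (-(n * t ^ 2 / 8)) := by
  have hind' : iIndepFun (fun i ω => Y i ω ^ 2 - 1) μ :=
    hind.comp (fun _ x => x ^ 2 - 1) (fun _ => by fun_prop)
  have hmgf : ∀ s : ℝ, |s| ≤ 1 / 4 →
      0 < mgf (∑ i, fun ω => Y i ω ^ 2 - 1) μ s ∧
      mgf (∑ i, fun ω => Y i ω ^ 2 - 1) μ s ≤ Real.exp (2 * n * s ^ 2) := by
    intro s hs
    rw [hind'.mgf_sum (fun i => by have := hY i; fun_prop)]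
    have h := fun i => chi_mgf (hY i).aemeasurable (hl i) s hs
    refine ⟨Finset.prod_pos fun i _ => (h i).1, ?_⟩
    calc _ ≤ ∏ i : Fin n, Real.exp (2 * s ^ 2) :=
          Finset.prod_le_prod (fun i _ => (h i).1.le) fun i _ => (h i).2
      _ = _ := by
          rw [Finset.prod_const, ← Real.exp_nat_mul]; simp; ring
  have hmgf_int : ∀ s : ℝ, |s| ≤ 1 / 4 →
      Integrable (fun ω => Real.exp (s * (∑ i, fun ω => Y i ω ^ 2 - 1 : Ω → ℝ) ω)) μ := by
    intro s hs
    by_contra hc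
    have := (hmgf s hs).1
    rw [mgf, integral_undef hc] at this
    exact lt_irrefl _ this
  have a1 : |t / 4| ≤ 1 / 4 := by rw [abs_of_nonneg (by positivity)]; linarith
  have a2 : |-(t / 4)| ≤ 1 / 4 := by rw [abs_neg]; exact a1
  have u1 := measure_ge_le_exp_mul_mgf (n * t) (by positivity : 0 ≤ t / 4) (hmgf_int _ a1)
  have u2 := measure_le_le_exp_mul_mgf (-(n * t)) (by linarith : -(t / 4) ≤ 0) (hmgf_int _ a2)
  have e1 : Real.exp (-(t / 4) * (n * t)) * Real.exp (2 * n * (t / 4) ^ 2) =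
      Real.exp (-(n * t ^ 2 / 8)) := by rw [← Real.exp_add]; congr 1; ring
  have e2 : Real.exp (- -(t / 4) * -(n * t)) * Real.exp (2 * n * (-(t / 4)) ^ 2) =
      Real.exp (-(n * t ^ 2 / 8)) := by rw [← Real.exp_add]; congr 1; ring
  have b1 := u1.trans ((mul_le_mul_of_nonneg_left (hmgf _ a1).2 (Real.exp_pos _).le).trans e1.le)
  have b2 := u2.trans ((mul_le_mul_of_nonneg_left (hmgf _ a2).2 (Real.exp_pos _).le).trans e2.le)
  have hsub : {ω | n * t ≤ |∑ i, (Y i ω ^ 2 - 1)|} ⊆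
      {ω | n * t ≤ (∑ i, fun ω => Y i ω ^ 2 - 1 : Ω → ℝ) ω} ∪
      {ω | (∑ i, fun ω => Y i ω ^ 2 - 1 : Ω → ℝ) ω ≤ -(n * t)} := by
    intro ω hω
    simp only [Set.mem_ofPred_eq, Set.mem_union, Finset.sum_apply] at hω ⊢
    rcases le_abs.1 hω with h | h
    · exact Or.inl h
    · exact Or.inr (by linarith)
  calc _ ≤ _ := measureReal_mono hsub
    _ ≤ _ := measureReal_union_le _ _
    _ ≤ _ := by linarith

/-- Rows of a standard Gaussian array, paired with a unit vector, are iid standard normal. -/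
lemma proj_law {Ω : Type*} [MeasurableSpace Ω] {μ : Measure Ω} [IsProbabilityMeasure μ] {n : ℕ}
    {ι : Type*} [Fintype ι] [DecidableEq ι] {H : Fin n × ι → Ω → ℝ} (hm : ∀ p, Measurable (H p))
    (hind : iIndepFun H μ) (hl : ∀ p, μ.map (H p) = gaussianReal 0 1)
    (u : ι → ℝ) (hu : u ⬝ᵥ u = 1) :
    iIndepFun (fun i ω => ∑ a, H (i, a) ω * u a) μ ∧
      ∀ i, μ.map (fun ω => ∑ a, H (i, a) ω * u a) = gaussianReal 0 1 := by
  have hg : ∀ p, HasGaussianLaw (H p) μ := fun p => ⟨by rw [hl p]; infer_instance⟩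
  have hjoint := hind.hasGaussianLaw hg
  let L : (Fin n × ι → ℝ) →L[ℝ] (Fin n → ℝ) :=
    ContinuousLinearMap.pi fun i => ∑ a, u a • ContinuousLinearMap.proj (R := ℝ) (φ := fun _ => ℝ) (i, a)
  have hLG : HasGaussianLaw (fun ω i => ∑ a, H (i, a) ω * u a) μ := by
    have := hjoint.map_fun L
    have e : (fun ω i => ∑ a, H (i, a) ω * u a) = fun ω => L (fun x => H x ω) := by
      funext ω i
      simp [L, mul_comm]
    rw [e]
    exact this
  have hmem : ∀ i a, MemLp (fun ω => H (i, a) ω * u a) 2 μ := fun i a =>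
    (hg (i, a)).memLp_two.mul_const _
  have hvar : ∀ p, Var[H p; μ] = 1 := by
    intro p
    rw [← variance_id_map (hm p).aemeasurable, hl p, variance_id_gaussianReal]; simp
  have hmean : ∀ p, ∫ ω, H p ω ∂μ = 0 := by
    intro p
    have : ∫ x, x ∂(μ.map (H p)) = ∫ ω, H p ω ∂μ :=
      integral_map (hm p).aemeasurable (by fun_prop)
    rw [← this, hl p, integral_id_gaussianReal]
  have hcovH : ∀ p q, cov[H p, H q; μ] = if p = q then 1 else 0 := by
    intro p q
    split_ifs with h
    · subst h; rw [covariance_self (hm p).aemeasurable, hvar]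
    · exact (hind.indepFun h).covariance_eq_zero (hg p).memLp_two (hg q).memLp_two
  have hcov : ∀ i j, cov[fun ω => ∑ a, H (i, a) ω * u a, fun ω => ∑ a, H (j, a) ω * u a; μ] =
      if i = j then 1 else 0 := by
    intro i j
    rw [covariance_fun_sum_fun_sum (hmem i) (hmem j)]
    simp_rw [covariance_mul_const_left, covariance_mul_const_right, hcovH]
    split_ifs with h
    · subst h
      simpa [dotProduct] using hu
    · simp [h]
  refine ⟨hLG.iIndepFun_of_covariance_eq_zero fun i j hij => by rw [hcov]; simp [hij], fun i => ?_⟩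
  have hgi : HasGaussianLaw (fun ω => ∑ a, H (i, a) ω * u a) μ := hLG.eval i
  rw [hgi.map_eq_gaussianReal]
  have hm0 : ∫ ω, ∑ a, H (i, a) ω * u a ∂μ = 0 := by
    rw [integral_finsetSum _ fun a _ => ((hmem i a).integrable (by norm_num))]
    simp [integral_mul_const, hmean]
  rw [hm0, ← covariance_self hgi.aemeasurable, hcov]
  simp

lemma quad_tail {Ω : Type*} [MeasurableSpace Ω] {μ : Measure Ω} [IsProbabilityMeasure μ] {n : ℕ}
    {ι : Type*} [Fintype ι] [DecidableEq ι] {H : Fin n × ι → Ω → ℝ} (hm : ∀ p, Measurable (H p))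
    (hind : iIndepFun H μ) (hl : ∀ p, μ.map (H p) = gaussianReal 0 1) (hn : 0 < n)
    (u : ι → ℝ) (t : ℝ) (ht : 0 ≤ t) (ht1 : t ≤ 1) :
    μ.real {ω | t * (u ⬝ᵥ u) < |(n : ℝ)⁻¹ * ∑ i, ((fun a => H (i, a) ω) ⬝ᵥ u) ^ 2 - u ⬝ᵥ u|} ≤
      2 * Real.exp (-(n * t ^ 2 / 8)) := by
  have hn' : (0 : ℝ) < n := by exact_mod_cast hn
  by_cases hu : u = 0
  · subst hu
    simp; positivity
  have hpos : 0 < u ⬝ᵥ u := by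
    have h0 : 0 ≤ u ⬝ᵥ u := Finset.sum_nonneg fun i _ => mul_self_nonneg _
    exact lt_of_le_of_ne h0 fun h => hu (dotProduct_self_eq_zero.1 h.symm)
  set r := √(u ⬝ᵥ u) with hr
  have hr0 : 0 < r := Real.sqrt_pos.2 hpos
  have hr2 : r ^ 2 = u ⬝ᵥ u := Real.sq_sqrt hpos.le
  have hw : (r⁻¹ • u) ⬝ᵥ (r⁻¹ • u) = 1 := by
    rw [smul_dotProduct, dotProduct_smul, ← hr2]; simp only [smul_eq_mul]; field_simp
  obtain ⟨h1, h2⟩ := proj_law hm hind hl (r⁻¹ • u) hw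
  have h3 := chi_tail (fun i => by fun_prop) h1 h2 t ht ht1
  refine le_trans (measureReal_mono ?_) h3
  intro ω hω
  simp only [Set.mem_ofPred_eq] at hω ⊢
  have e : ∀ i, ∑ a, H (i, a) ω * (r⁻¹ • u) a = r⁻¹ * ((fun a => H (i, a) ω) ⬝ᵥ u) := by
    intro i
    simp only [dotProduct, Pi.smul_apply, smul_eq_mul, Finset.mul_sum]
    exact Finset.sum_congr rfl fun a _ => by ring
  simp_rw [e]
  have e2 : ∑ i, ((r⁻¹ * ((fun a => H (i, a) ω) ⬝ᵥ u)) ^ 2 - 1) =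
      (n / r ^ 2) * ((n : ℝ)⁻¹ * ∑ i, ((fun a => H (i, a) ω) ⬝ᵥ u) ^ 2 - u ⬝ᵥ u) := by
    rw [Finset.sum_sub_distrib, ← hr2]
    simp_rw [mul_pow, ← Finset.mul_sum]
    simp
    field_simp
  rw [e2, abs_mul, abs_of_pos (by positivity)]
  rw [← hr2] at hω ⊢
  calc (n : ℝ) * t = n / r ^ 2 * (t * r ^ 2) := by field_simp
    _ ≤ _ := by gcongr


/-- The centred empirical covariance form. -/
noncomputable def Bform {n : ℕ} {ι : Type*} [Fintype ι] (X : Fin n → ι → ℝ) (p q : ι → ℝ) : ℝ :=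
  (n : ℝ)⁻¹ * ∑ i, (X i ⬝ᵥ p) * (X i ⬝ᵥ q) - p ⬝ᵥ q

lemma Bform_comm {n : ℕ} {ι : Type*} [Fintype ι] (X : Fin n → ι → ℝ) (p q : ι → ℝ) :
    Bform X p q = Bform X q p := by
  simp only [Bform, dotProduct_comm p q, mul_comm]

lemma Bform_add {n : ℕ} {ι : Type*} [Fintype ι] (X : Fin n → ι → ℝ) (p q r : ι → ℝ) :
    Bform X (p + q) r = Bform X p r + Bform X q r := by
  simp only [Bform, dotProduct_add, add_dotProduct, add_mul, Finset.sum_add_distrib]; ring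

lemma Bform_smul {n : ℕ} {ι : Type*} [Fintype ι] (X : Fin n → ι → ℝ) (c : ℝ) (p r : ι → ℝ) :
    Bform X (c • p) r = c * Bform X p r := by
  simp only [Bform, dotProduct_smul, smul_dotProduct, smul_eq_mul, mul_assoc, ← Finset.mul_sum]
  ring

lemma Bform_add_right {n : ℕ} {ι : Type*} [Fintype ι] (X : Fin n → ι → ℝ) (p q r : ι → ℝ) :
    Bform X r (p + q) = Bform X r p + Bform X r q := by
  rw [Bform_comm, Bform_add, Bform_comm X p, Bform_comm X q]

lemma Bform_smul_right {n : ℕ} {ι : Type*} [Fintype ι] (X : Fin n → ι → ℝ) (c : ℝ) (p r : ι → ℝ) :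
    Bform X r (c • p) = c * Bform X r p := by
  rw [Bform_comm, Bform_smul, Bform_comm X p]

lemma dot_self_nonneg' {ι : Type*} [Fintype ι] (p : ι → ℝ) : 0 ≤ p ⬝ᵥ p :=
  Finset.sum_nonneg fun _ _ => mul_self_nonneg _

/-- Polarization. -/
lemma Bform_polar {n : ℕ} {ι : Type*} [Fintype ι] (X : Fin n → ι → ℝ) (S : Finset ι) (K : ℝ)
    (hK : ∀ u : ι → ℝ, (∀ a ∉ S, u a = 0) → |Bform X u u| ≤ K * (u ⬝ᵥ u))
    (p q : ι → ℝ) (hp : ∀ a ∉ S, p a = 0) (hq : ∀ a ∉ S, q a = 0) :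
    |2 * Bform X p q| ≤ K * (p ⬝ᵥ p + q ⬝ᵥ q) := by
  have h1 := hK (p + q) (fun a ha => by simp [hp a ha, hq a ha])
  have h2 := hK (p + (-1 : ℝ) • q) (fun a ha => by simp [hp a ha, hq a ha])
  simp only [Bform_add, Bform_add_right, Bform_smul, Bform_smul_right, add_dotProduct,
    dotProduct_add, smul_dotProduct, dotProduct_smul, smul_eq_mul, Bform_comm X q p,
    dotProduct_comm q p] at h1 h2
  rw [abs_le] at h1 h2 ⊢
  constructor <;> linarith [h1.1, h1.2, h2.1, h2.2]

lemma Bform_cs {n : ℕ} {ι : Type*} [Fintype ι] (X : Fin n → ι → ℝ) (S : Finset ι) (K : ℝ)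
    (hK : ∀ u : ι → ℝ, (∀ a ∉ S, u a = 0) → |Bform X u u| ≤ K * (u ⬝ᵥ u))
    (p q : ι → ℝ) (hp : ∀ a ∉ S, p a = 0) (hq : ∀ a ∉ S, q a = 0) (α β : ℝ) (hα : 0 < α)
    (hβ : 0 < β) (hpα : p ⬝ᵥ p ≤ α ^ 2) (hqβ : q ⬝ᵥ q ≤ β ^ 2) (hK0 : 0 ≤ K) :
    |Bform X p q| ≤ K * (α * β) := by
  have h := Bform_polar X S K hK (β • p) (α • q) (fun a ha => by simp [hp a ha])
    (fun a ha => by simp [hq a ha])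
  simp only [Bform_smul, Bform_smul_right, smul_dotProduct, dotProduct_smul, smul_eq_mul] at h
  have e : 2 * (α * (β * Bform X p q)) = (2 * (α * β)) * Bform X p q := by ring
  rw [e, abs_mul, abs_of_pos (by positivity)] at h
  have h2 : K * (β * (β * p ⬝ᵥ p) + α * (α * q ⬝ᵥ q)) ≤ K * (2 * (α * β) * (α * β)) := by
    apply mul_le_mul_of_nonneg_left _ hK0
    have := mul_le_mul_of_nonneg_left hpα (sq_nonneg β)
    have := mul_le_mul_of_nonneg_left hqβ (sq_nonneg α)
    nlinarith
  have h3 : (2 * (α * β)) * |Bform X p q| ≤ (2 * (α * β)) * (K * (α * β)) := by linarith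
  exact le_of_mul_le_mul_left h3 (by positivity)

/-- A crude bound, to start the net argument. -/
lemma Bform_crude {n : ℕ} {ι : Type*} [Fintype ι] (X : Fin n → ι → ℝ) :
    ∃ K : ℝ, 0 ≤ K ∧ ∀ u : ι → ℝ, |Bform X u u| ≤ K * (u ⬝ᵥ u) := by
  refine ⟨(n : ℝ)⁻¹ * ∑ i, (X i ⬝ᵥ X i) + 1, ?_, fun u => ?_⟩
  · have := Finset.sum_nonneg fun i (_ : i ∈ Finset.univ) => dot_self_nonneg' (X i)
    positivity
  · have hcs : ∀ i, (X i ⬝ᵥ u) * (X i ⬝ᵥ u) ≤ (X i ⬝ᵥ X i) * (u ⬝ᵥ u) := by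
      intro i
      have := Finset.sum_mul_sq_le_sq_mul_sq Finset.univ (X i) u
      simp only [dotProduct]
      simpa only [sq] using this
    have h1 : 0 ≤ (n : ℝ)⁻¹ * ∑ i, (X i ⬝ᵥ u) * (X i ⬝ᵥ u) := by
      have := Finset.sum_nonneg fun i (_ : i ∈ Finset.univ) => mul_self_nonneg (X i ⬝ᵥ u)
      positivity
    have h2 : (n : ℝ)⁻¹ * ∑ i, (X i ⬝ᵥ u) * (X i ⬝ᵥ u) ≤
        (n : ℝ)⁻¹ * ∑ i, (X i ⬝ᵥ X i) * (u ⬝ᵥ u) := by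
      exact mul_le_mul_of_nonneg_left (Finset.sum_le_sum fun i _ => hcs i) (by positivity)
    have h3 := dot_self_nonneg' u
    have h4 : (0:ℝ) ≤ (n : ℝ)⁻¹ * ∑ i, (X i ⬝ᵥ X i) * (u ⬝ᵥ u) := h1.trans h2
    rw [← Finset.sum_mul] at h2 h4
    unfold Bform
    rw [abs_le]
    constructor <;> linarith

/-- One step of the net argument. -/
lemma net_step {n : ℕ} {ι : Type*} [Fintype ι] (X : Fin n → ι → ℝ) (S : Finset ι) (m : ℕ)
    (hm : 0 < m) (hS : S.card ≤ m) (t K : ℝ) (ht : 0 ≤ t) (hK0 : 0 ≤ K)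
    (hnet : ∀ f : ι → ℤ, (∀ a ∉ S, f a = 0) → (∀ a, |f a| ≤ 4 * m) →
      |Bform X (fun a => (f a : ℝ) / (4 * m)) (fun a => (f a : ℝ) / (4 * m))| ≤
        t * ((fun a => (f a : ℝ) / (4 * m)) ⬝ᵥ (fun a => (f a : ℝ) / (4 * m))))
    (hK : ∀ u : ι → ℝ, (∀ a ∉ S, u a = 0) → |Bform X u u| ≤ K * (u ⬝ᵥ u))
    (u : ι → ℝ) (huS : ∀ a ∉ S, u a = 0) :
    |Bform X u u| ≤ (17 / 8 * t + 9 / 16 * K) * (u ⬝ᵥ u) := by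
  suffices H : ∀ u : ι → ℝ, (∀ a ∉ S, u a = 0) → u ⬝ᵥ u = 1 →
      |Bform X u u| ≤ 17 / 8 * t + 9 / 16 * K by
    by_cases hu : u = 0
    · subst hu; simp [Bform]
    have hpos : 0 < u ⬝ᵥ u :=
      lt_of_le_of_ne (dot_self_nonneg' u) fun h => hu (dotProduct_self_eq_zero.1 h.symm)
    set r := √(u ⬝ᵥ u) with hr
    have hr0 : 0 < r := Real.sqrt_pos.2 hpos
    have hr2 : r ^ 2 = u ⬝ᵥ u := Real.sq_sqrt hpos.le
    have h := H (r⁻¹ • u) (fun a ha => by simp [huS a ha])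
      (by rw [smul_dotProduct, dotProduct_smul, ← hr2]; simp only [smul_eq_mul]; field_simp)
    rw [Bform_smul, Bform_smul_right, ← mul_assoc, abs_mul, abs_of_pos (by positivity)] at h
    rw [← hr2]
    calc |Bform X u u| = (r⁻¹ * r⁻¹ * |Bform X u u|) * r ^ 2 := by field_simp
      _ ≤ _ := by gcongr
  clear huS u
  intro u huS hu1
  have hm' : (0 : ℝ) < m := by exact_mod_cast hm
  have hm1 : (1 : ℝ) ≤ m := by exact_mod_cast hm
  let f : ι → ℤ := fun a => round (4 * m * u a)
  have hf0 : ∀ a ∉ S, f a = 0 := fun a ha => by simp [f, huS a ha]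
  have hu_le : ∀ a, |u a| ≤ 1 := by
    intro a
    have h1 : u a * u a ≤ u ⬝ᵥ u :=
      Finset.single_le_sum (f := fun a => u a * u a) (fun i _ => mul_self_nonneg _) (Finset.mem_univ a)
    rw [hu1] at h1
    exact abs_le_one_iff_mul_self_le_one.2 h1
  have hround : ∀ a, |4 * m * u a - f a| ≤ 1 / 2 := fun a => abs_sub_round _
  have hfb : ∀ a, |f a| ≤ 4 * m := by
    intro a
    have h1 := abs_le.1 (hround a)
    have h2 := abs_le.1 (hu_le a)
    have h3 : (4 * m * u a) ≤ 4 * m := by nlinarith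
    have h4 : -(4 * m : ℝ) ≤ 4 * m * u a := by nlinarith
    have h5 : ((f a : ℤ) : ℝ) < ((4 * m + 1 : ℤ) : ℝ) := by push_cast; linarith
    have h6 : ((-(4 * m) - 1 : ℤ) : ℝ) < ((f a : ℤ) : ℝ) := by push_cast; linarith
    have h5' := Int.cast_lt.1 h5
    have h6' := Int.cast_lt.1 h6
    rw [abs_le]; constructor <;> omega
  set ν : ι → ℝ := fun a => (f a : ℝ) / (4 * m) with hν
  have hQν := hnet f hf0 hfb
  have hνS : ∀ a ∉ S, ν a = 0 := fun a ha => by simp [hν, hf0 a ha]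
  set h : ι → ℝ := u + (-1 : ℝ) • ν with hh
  have hhS : ∀ a ∉ S, h a = 0 := fun a ha => by simp [hh, huS a ha, hνS a ha]
  have hha : ∀ a, h a * h a ≤ (1 / (8 * m)) ^ 2 := by
    intro a
    have e : h a = (4 * m * u a - f a) / (4 * m) := by
      simp only [hh, hν, Pi.add_apply, Pi.smul_apply, smul_eq_mul]; field_simp; ring
    rw [← sq, ← sq_abs]
    have : |h a| ≤ 1 / (8 * m) := by
      rw [e, abs_div, abs_of_pos (by positivity : (0:ℝ) < 4 * m), div_le_div_iff₀ (by positivity) (by positivity)]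
      nlinarith [hround a]
    exact pow_le_pow_left₀ (abs_nonneg _) this 2
  have hhh : h ⬝ᵥ h ≤ 1 / 16 := by
    have e : h ⬝ᵥ h = ∑ a ∈ S, h a * h a := by
      symm
      exact Finset.sum_subset (Finset.subset_univ S) fun a _ ha => by simp [hhS a ha]
    rw [e]
    calc _ ≤ ∑ a ∈ S, ((1 : ℝ) / (8 * m)) ^ 2 := Finset.sum_le_sum fun a _ => hha a
      _ = S.card * (1 / (8 * m)) ^ 2 := by simp
      _ ≤ m * (1 / (8 * m)) ^ 2 := by gcongr
      _ = 1 / (64 * m) := by field_simp; norm_num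
      _ ≤ 1 / 16 := by apply one_div_le_one_div_of_le <;> linarith
  have hhn := dot_self_nonneg' h
  have hu_eq : ν = u + (-1 : ℝ) • h := by
    funext a; simp [hh]
  have hνν : ν ⬝ᵥ ν ≤ 17 / 8 := by
    have h1 := dot_self_nonneg' (u + h)
    rw [hu_eq]
    simp only [add_dotProduct, dotProduct_add, smul_dotProduct, dotProduct_smul, smul_eq_mul,
      dotProduct_comm h u, hu1] at h1 ⊢
    linarith
  have hpol := Bform_polar X S K hK ((1 / 2 : ℝ) • u) ((2 : ℝ) • h)
    (fun a ha => by simp [huS a ha]) (fun a ha => by simp [hhS a ha])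
  have hQh := hK h hhS
  simp only [Bform_smul, Bform_smul_right, smul_dotProduct, dotProduct_smul, smul_eq_mul, hu1] at hpol
  have hQu : Bform X u u = Bform X ν ν + 2 * Bform X u h - Bform X h h := by
    rw [hu_eq]
    simp only [Bform_add, Bform_add_right, Bform_smul, Bform_smul_right, Bform_comm X h u]
    ring
  have b1 : t * (ν ⬝ᵥ ν) ≤ t * (17 / 8) := mul_le_mul_of_nonneg_left hνν ht
  have b2 : K * (h ⬝ᵥ h) ≤ K * (1 / 16) := mul_le_mul_of_nonneg_left hhh hK0
  rw [abs_le] at hQν hpol hQh ⊢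
  rw [hQu]
  constructor <;> nlinarith [hQν.1, hQν.2, hpol.1, hpol.2, hQh.1, hQh.2]

lemma net_full {n : ℕ} {ι : Type*} [Fintype ι] (X : Fin n → ι → ℝ) (S : Finset ι) (m : ℕ)
    (hm : 0 < m) (hS : S.card ≤ m) (t : ℝ) (ht : 0 ≤ t)
    (hnet : ∀ f : ι → ℤ, (∀ a ∉ S, f a = 0) → (∀ a, |f a| ≤ 4 * m) →
      |Bform X (fun a => (f a : ℝ) / (4 * m)) (fun a => (f a : ℝ) / (4 * m))| ≤
        t * ((fun a => (f a : ℝ) / (4 * m)) ⬝ᵥ (fun a => (f a : ℝ) / (4 * m))))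
    (u : ι → ℝ) (huS : ∀ a ∉ S, u a = 0) :
    |Bform X u u| ≤ 5 * t * (u ⬝ᵥ u) := by
  obtain ⟨K0, hK0, hK⟩ := Bform_crude X
  have hiter : ∀ j : ℕ, ∀ u : ι → ℝ, (∀ a ∉ S, u a = 0) →
      |Bform X u u| ≤ (5 * t + (9 / 16) ^ j * K0) * (u ⬝ᵥ u) := by
    intro j
    induction j with
    | zero =>
      intro u _
      refine (hK u).trans ?_
      have := dot_self_nonneg' u
      gcongr; simp; exact ht
    | succ j ih =>
      intro u hu
      refine (net_step X S m hm hS t _ ht (by positivity) hnet ih u hu).trans ?_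
      have := dot_self_nonneg' u
      apply mul_le_mul_of_nonneg_right _ this
      rw [pow_succ]
      nlinarith
  have hlim : Filter.Tendsto (fun j : ℕ => (5 * t + (9 / 16 : ℝ) ^ j * K0) * (u ⬝ᵥ u)) Filter.atTop
      (nhds ((5 * t + 0 * K0) * (u ⬝ᵥ u))) :=
    (((tendsto_pow_atTop_nhds_zero_of_lt_one (by norm_num) (by norm_num)).mul_const K0).const_add
      (5 * t)).mul_const _
  have := ge_of_tendsto' hlim (fun j => hiter j u huS)
  simpa using this


/-- The finite net: integer vectors supported on the range of some `Fin m → ι`. -/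
noncomputable def netSet (ι : Type*) [Fintype ι] [DecidableEq ι] (m : ℕ) : Finset (ι → ℤ) :=
  (Finset.univ : Finset (Fin m → ι)).biUnion fun g =>
    Fintype.piFinset fun a =>
      if a ∈ Finset.univ.image g then Finset.Icc (-(4 * m : ℤ)) (4 * m) else {0}

lemma netSet_card (ι : Type*) [Fintype ι] [DecidableEq ι] (m : ℕ) :
    (netSet ι m).card ≤ Fintype.card ι ^ m * (8 * m + 1) ^ m := by
  have h := Finset.card_biUnion_le_card_mul (Finset.univ : Finset (Fin m → ι))
    (fun g => Fintype.piFinset fun a =>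
      if a ∈ Finset.univ.image g then Finset.Icc (-(4 * m : ℤ)) (4 * m) else {0})
    ((8 * m + 1) ^ m) (fun g _ => by
      rw [Fintype.card_piFinset]
      have e : ∀ a, (if a ∈ Finset.univ.image g then Finset.Icc (-(4 * m : ℤ)) (4 * m) else {0}).card
          = if a ∈ Finset.univ.image g then 8 * m + 1 else 1 := by
        intro a
        split_ifs
        · rw [Int.card_Icc]; omega
        · simp
      simp_rw [e]
      rw [Finset.prod_ite_mem, Finset.univ_inter, Finset.prod_const]
      apply Nat.pow_le_pow_right (by omega)
      exact Finset.card_image_le.trans (by simp))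
  refine h.trans ?_
  simp

lemma mem_netSet {ι : Type*} [Fintype ι] [DecidableEq ι] [Nonempty ι] (m : ℕ) (S : Finset ι)
    (hS : S.card ≤ m) (f : ι → ℤ) (hf : ∀ a ∉ S, f a = 0) (hb : ∀ a, |f a| ≤ 4 * m) :
    f ∈ netSet ι m := by
  classical
  let g : Fin m → ι := fun l =>
    if h : (l : ℕ) < S.card then (S.equivFin.symm ⟨l, h⟩ : ι) else Classical.arbitrary ι
  rw [netSet, Finset.mem_biUnion]
  refine ⟨g, Finset.mem_univ _, ?_⟩
  rw [Fintype.mem_piFinset]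
  intro a
  by_cases ha : a ∈ S
  · have : a ∈ Finset.univ.image g := by
      rw [Finset.mem_image]
      refine ⟨Fin.castLE hS (S.equivFin ⟨a, ha⟩), Finset.mem_univ _, ?_⟩
      simp [g]
    rw [if_pos this, Finset.mem_Icc]
    exact abs_le.1 (hb a)
  · rw [hf a ha]
    split_ifs <;> simp

lemma good_event {Ω : Type*} [MeasurableSpace Ω] {μ : Measure Ω} [IsProbabilityMeasure μ] {n : ℕ}
    {ι : Type*} [Fintype ι] [DecidableEq ι] [Nonempty ι] {H : Fin n × ι → Ω → ℝ}
    (hm : ∀ p, Measurable (H p))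
    (hind : iIndepFun H μ) (hl : ∀ p, μ.map (H p) = gaussianReal 0 1) (hn : 0 < n)
    (m : ℕ) (hm0 : 0 < m) (t : ℝ) (ht : 0 ≤ t) (ht1 : t ≤ 1) :
    μ.real {ω | ¬ ∀ S : Finset ι, S.card ≤ m → ∀ u : ι → ℝ, (∀ a ∉ S, u a = 0) →
        |Bform (fun i a => H (i, a) ω) u u| ≤ 5 * t * (u ⬝ᵥ u)} ≤
      ((Fintype.card ι : ℝ) ^ m * (8 * m + 1) ^ m) * (2 * Real.exp (-(n * t ^ 2 / 8))) := by
  let w : (ι → ℤ) → ι → ℝ := fun f a => (f a : ℝ) / (4 * m)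
  have hsub : {ω | ¬ ∀ S : Finset ι, S.card ≤ m → ∀ u : ι → ℝ, (∀ a ∉ S, u a = 0) →
        |Bform (fun i a => H (i, a) ω) u u| ≤ 5 * t * (u ⬝ᵥ u)} ⊆
      ⋃ f ∈ netSet ι m, {ω | t * (w f ⬝ᵥ w f) <
        |(n : ℝ)⁻¹ * ∑ i, ((fun a => H (i, a) ω) ⬝ᵥ w f) ^ 2 - w f ⬝ᵥ w f|} := by
    intro ω hω
    by_contra hc
    apply hω
    intro S hS u hu
    refine net_full _ S m hm0 hS t ht (fun f hf hb => ?_) u hu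
    by_contra hlt
    apply hc
    rw [Set.mem_iUnion₂]
    refine ⟨f, mem_netSet m S hS f hf hb, ?_⟩
    rw [not_le] at hlt
    simpa only [Set.mem_ofPred_eq, Bform, sq, w] using hlt
  calc _ ≤ μ.real (⋃ f ∈ netSet ι m, {ω | t * (w f ⬝ᵥ w f) <
        |(n : ℝ)⁻¹ * ∑ i, ((fun a => H (i, a) ω) ⬝ᵥ w f) ^ 2 - w f ⬝ᵥ w f|}) :=
        measureReal_mono hsub (measure_ne_top _ _)
    _ ≤ ∑ f ∈ netSet ι m, _ := measureReal_biUnion_finset_le _ _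
    _ ≤ ∑ f ∈ netSet ι m, 2 * Real.exp (-(n * t ^ 2 / 8)) :=
        Finset.sum_le_sum fun f _ => quad_tail hm hind hl hn (w f) t ht ht1
    _ = (netSet ι m).card * (2 * Real.exp (-(n * t ^ 2 / 8))) := by simp
    _ ≤ _ := by
        gcongr
        exact_mod_cast netSet_card ι m

lemma count_bound (d k : ℕ) (hk : 1 ≤ k) (hkd : k + 2 ≤ d) :
    (((d + 1 : ℕ) : ℝ) ^ (10 * k) * (8 * ((10 * k : ℕ) : ℝ) + 1) ^ (10 * k)) *
      (2 * Real.exp (-(80 * (k * Real.log d)))) ≤ Real.exp (-k) := by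
  have hd3 : (3 : ℝ) ≤ d := by exact_mod_cast (by omega : 3 ≤ d)
  have hk1 : (1 : ℝ) ≤ k := by exact_mod_cast hk
  have hkd' : (k : ℝ) ≤ d := by exact_mod_cast (by omega : k ≤ d)
  have hlog : 1 ≤ Real.log d := by
    rw [Real.le_log_iff_exp_le (by linarith)]
    linarith [Real.exp_one_lt_d9]
  have h1 : ((d + 1 : ℕ) : ℝ) ≤ (d : ℝ) ^ 2 := by push_cast; nlinarith
  have h2 : 8 * ((10 * k : ℕ) : ℝ) + 1 ≤ (d : ℝ) ^ 5 := by
    push_cast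
    have : (81 : ℝ) ≤ (d : ℝ) ^ 4 := by
      calc (81 : ℝ) = 3 ^ 4 := by norm_num
        _ ≤ _ := by gcongr
    calc 8 * (10 * (k : ℝ)) + 1 ≤ 81 * d := by linarith
      _ ≤ (d : ℝ) ^ 4 * d := by gcongr
      _ = _ := by ring
  have h3 : (((d + 1 : ℕ) : ℝ) ^ (10 * k) * (8 * ((10 * k : ℕ) : ℝ) + 1) ^ (10 * k)) ≤
      Real.exp (70 * (k * Real.log d)) := by
    calc _ ≤ ((d : ℝ) ^ 2) ^ (10 * k) * ((d : ℝ) ^ 5) ^ (10 * k) := by gcongr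
      _ = (d : ℝ) ^ (70 * k) := by rw [← mul_pow, ← pow_add, ← pow_mul]; congr 1; ring
      _ = Real.exp (70 * (k * Real.log d)) := by
          rw [← Real.exp_log (show (0:ℝ) < d by linarith), ← Real.exp_nat_mul, Real.log_exp]
          congr 1; push_cast; ring
  have h4 : (2 : ℝ) ≤ Real.exp 1 := by linarith [Real.add_one_le_exp (1 : ℝ)]
  calc _ ≤ Real.exp (70 * (k * Real.log d)) * (Real.exp 1 * Real.exp (-(80 * (k * Real.log d)))) := by
        gcongr
    _ = Real.exp (1 - 10 * (k * Real.log d)) := by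
        rw [← Real.exp_add, ← Real.exp_add]; congr 1; ring
    _ ≤ _ := by
        apply Real.exp_le_exp.2
        nlinarith

/-- Lift of a vector to `ℝ^{1+d}`. -/
noncomputable def lift {d : ℕ} (lam : ℝ) (vstar u : Fin d → ℝ) : Option (Fin d) → ℝ :=
  fun o => o.elim (√lam * ip vstar u) u

lemma lift_dot {d : ℕ} (lam : ℝ) (hl : 0 ≤ lam) (vstar u v : Fin d → ℝ) :
    lift lam vstar u ⬝ᵥ lift lam vstar v = lam * ip vstar u * ip vstar v + ip u v := by
  simp only [dotProduct, Fintype.sum_option, lift, Option.elim, ip]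
  have := Real.mul_self_sqrt hl
  congr 1
  linear_combination (∑ i, vstar i * u i) * (∑ i, vstar i * v i) * this

lemma nrm_sq {d : ℕ} (v : Fin d → ℝ) : nrm v ^ 2 = ip v v := by
  rw [nrm, Real.sq_sqrt (Finset.sum_nonneg fun _ _ => sq_nonneg _)]
  simp only [ip, sq]

lemma nrm_nonneg {d : ℕ} (v : Fin d → ℝ) : 0 ≤ nrm v := Real.sqrt_nonneg _

lemma ip_comm {d : ℕ} (u v : Fin d → ℝ) : ip u v = ip v u := by
  simp only [ip, mul_comm]

lemma ip_sub_left {d : ℕ} (u v w : Fin d → ℝ) : ip (u - v) w = ip u w - ip v w := by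
  simp only [ip, Pi.sub_apply, sub_mul, Finset.sum_sub_distrib]

lemma ip_sub_right {d : ℕ} (u v w : Fin d → ℝ) : ip w (u - v) = ip w u - ip w v := by
  simp only [ip, Pi.sub_apply, mul_sub, Finset.sum_sub_distrib]

lemma ip_le {d : ℕ} (u v : Fin d → ℝ) : |ip u v| ≤ nrm u * nrm v := by
  apply abs_le_of_sq_le_sq _ (mul_nonneg (nrm_nonneg _) (nrm_nonneg _))
  have := Finset.sum_mul_sq_le_sq_mul_sq Finset.univ u v
  rw [mul_pow, nrm_sq, nrm_sq]
  simpa only [ip, sq] using this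

lemma power_real (s D E η c b q : ℝ) (hs8 : 8 ≤ s) (hDpos : 0 < D) (hE0 : 0 ≤ E) (hη0 : 0 ≤ η)
    (hη : η ≤ 1 / 8) (hc : 1 / 2 ≤ c) (hopt : 0 ≤ -(s ^ 2 * D ^ 2 / 2 * c) + q + b)
    (hdv : q ≤ D * E - D ^ 2 / 2) (hB' : b ≤ η * ((s * D ^ 2 / 2 + D) * (s + 1))) :
    D ≤ 1 / 8 * E + 2 * η := by
  have hs0 : 0 < s := by linarith
  have hA : 0 ≤ D * (-(s ^ 2 * D / 4) + E + η * ((s * D / 2 + 1) * (s + 1))) := by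
    have h2 : s ^ 2 * D ^ 2 / 2 * (1 / 2) ≤ s ^ 2 * D ^ 2 / 2 * c :=
      mul_le_mul_of_nonneg_left hc (by positivity)
    have h3 : 0 ≤ D ^ 2 := sq_nonneg D
    have e : D * (-(s ^ 2 * D / 4) + E + η * ((s * D / 2 + 1) * (s + 1))) =
      -(s ^ 2 * D ^ 2 / 2 * (1 / 2)) + D * E + η * ((s * D ^ 2 / 2 + D) * (s + 1)) := by ring
    rw [e]
    linarith
  have hA' := nonneg_of_mul_nonneg_right hA hDpos
  have h4 : η * (s * D / 2 * (s + 1)) ≤ 1 / 8 * (s * D / 2 * (s + 1)) :=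
    mul_le_mul_of_nonneg_right hη (by positivity)
  have h5 : s * D / 2 * (s + 1) ≤ s ^ 2 * D := by
    have : s * D / 2 * (s + 1) ≤ s * D / 2 * (s + s) :=
      mul_le_mul_of_nonneg_left (by linarith) (by positivity)
    have e : s * D / 2 * (s + s) = s ^ 2 * D := by ring
    linarith
  have e : η * ((s * D / 2 + 1) * (s + 1)) = η * (s * D / 2 * (s + 1)) + η * (s + 1) := by ring
  have h6 : s ^ 2 * D ≤ 8 * E + 8 * (η * (s + 1)) := by linarith
  have h7 : s * (s * D) ≤ s * (E + 16 * η) := by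
    have a1 : 8 * E ≤ s * E := mul_le_mul_of_nonneg_right hs8 hE0
    have a2 : η * (s + 1) ≤ η * (s + s) := mul_le_mul_of_nonneg_left (by linarith) hη0
    have e1 : s * (s * D) = s ^ 2 * D := by ring
    have e2 : s * (E + 16 * η) = s * E + 8 * (η * (s + s)) := by ring
    linarith
  have h8 := le_of_mul_le_mul_left h7 hs0
  have h9 : 8 * D ≤ s * D := mul_le_mul_of_nonneg_right hs8 hDpos.le
  linarith

/-- One step of the projected power method. -/
lemma power_step {d n : ℕ} (X : Fin n → Option (Fin d) → ℝ) (S : Finset (Option (Fin d)))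
    (lam η : ℝ) (hlam : 64 ≤ lam) (hη0 : 0 ≤ η) (hη : η ≤ 1 / 8)
    (hK : ∀ u : Option (Fin d) → ℝ, (∀ a ∉ S, u a = 0) → |Bform X u u| ≤ η * (u ⬝ᵥ u))
    (vs v w : Fin d → ℝ) (hvs : nrm vs = 1) (hv : nrm v = 1) (hw : nrm w = 1)
    (hc : 1 / 2 ≤ ip v vs) (hnS : none ∈ S)
    (hSs : ∀ i, some i ∉ S → vs i = 0) (hSv : ∀ i, some i ∉ S → v i = 0)
    (hSw : ∀ i, some i ∉ S → w i = 0)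
    (hopt : 0 ≤ lift lam vs (w - vs) ⬝ᵥ lift lam vs v + Bform X (lift lam vs (w - vs)) (lift lam vs v)) :
    nrm (w - vs) ≤ 1 / 8 * nrm (v - vs) + 2 * η := by
  set D := nrm (w - vs) with hD
  set E := nrm (v - vs) with hE
  have hD0 : 0 ≤ D := nrm_nonneg _
  have hE0 : 0 ≤ E := nrm_nonneg _
  rcases hD0.eq_or_lt with h | hDpos
  · rw [← h]; positivity
  have hl0 : 0 ≤ lam := by linarith
  set s := √lam with hs
  have hs2 : s ^ 2 = lam := Real.sq_sqrt hl0
  have hs8 : 8 ≤ s := by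
    apply Real.le_sqrt_of_sq_le; linarith
  have hvs2 : ip vs vs = 1 := by rw [← nrm_sq, hvs]; norm_num
  have hv2 : ip v v = 1 := by rw [← nrm_sq, hv]; norm_num
  have hw2 : ip w w = 1 := by rw [← nrm_sq, hw]; norm_num
  have hDD : ip (w - vs) (w - vs) = D ^ 2 := (nrm_sq _).symm
  have hvd : ip vs (w - vs) = -(D ^ 2 / 2) := by
    have : D ^ 2 = 2 - 2 * ip vs w := by
      rw [← hDD]
      simp only [ip_sub_left, ip_sub_right, hvs2, hw2, ip_comm w vs]; ring
    rw [ip_sub_right, hvs2]; linarith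
  have hc1 : ip vs v ≤ 1 := by
    have := (abs_le.1 (ip_le vs v)).2
    rwa [hvs, hv, one_mul] at this
  rw [ip_comm] at hc
  set c := ip vs v with hcdef
  have hsupp : ∀ u : Fin d → ℝ, (∀ i, some i ∉ S → u i = 0) → ∀ a ∉ S, lift lam vs u a = 0 := by
    intro u hu a ha
    cases a with
    | none => exact absurd hnS ha
    | some i => exact hu i ha
  have hB := Bform_cs X S η hK (lift lam vs (w - vs)) (lift lam vs v)
    (hsupp _ fun i hi => by simp [hSs i hi, hSw i hi]) (hsupp _ hSv)
    (s * D ^ 2 / 2 + D) (s + 1) (by positivity) (by positivity)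
    (by
      rw [lift_dot _ hl0, hvd, hDD, ← hs2]
      have : 0 ≤ s * D ^ 2 / 2 * D := by positivity
      nlinarith)
    (by
      rw [lift_dot _ hl0, hv2, ← hs2, ← hcdef]
      have : c * c ≤ 1 := by nlinarith
      nlinarith [sq_nonneg s])
    hη0
  rw [lift_dot _ hl0, hvd, ← hcdef] at hopt
  have hdv : ip (w - vs) v ≤ D * E - D ^ 2 / 2 := by
    have h1 := (abs_le.1 (ip_le (w - vs) (v - vs))).2
    rw [ip_sub_right, ip_comm (w - vs) vs, hvd] at h1
    linarith
  have hB' := (abs_le.1 hB).2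
  have hl2 : lam * -(D ^ 2 / 2) * c = -(s ^ 2 * D ^ 2 / 2 * c) := by rw [hs2]; ring
  rw [hl2] at hopt
  generalize Bform X (lift lam vs (w - vs)) (lift lam vs v) = b at hopt hB'
  refine power_real s D E η c b _ hs8 hDpos hE0 hη0 hη hc hopt hdv hB'


lemma path_card {d k : ℕ} (G : LayeredGraph d k) (P : Finset (Fin d)) (hP : G.IsPathSet P) :
    P.card ≤ k + 2 := by
  have hsub : P ⊆ ({G.vs, G.vt} : Finset (Fin d)) ∪
      (Finset.univ : Finset (Fin k)).biUnion fun j => P ∩ G.V j := by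
    intro i hi
    by_cases h1 : i = G.vs
    · simp [h1]
    by_cases h2 : i = G.vt
    · simp [h2]
    obtain ⟨j, hj⟩ := G.hcover i h1 h2
    rw [Finset.mem_union, Finset.mem_biUnion]
    exact Or.inr ⟨j, Finset.mem_univ _, Finset.mem_inter.2 ⟨hi, hj⟩⟩
  have h1 := Finset.card_le_card hsub
  have h2 := Finset.card_union_le ({G.vs, G.vt} : Finset (Fin d))
    ((Finset.univ : Finset (Fin k)).biUnion fun j => P ∩ G.V j)
  have h3 : ({G.vs, G.vt} : Finset (Fin d)).card ≤ 2 := Finset.card_le_two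
  have h4 := Finset.card_biUnion_le_card_mul (Finset.univ : Finset (Fin k))
    (fun j => P ∩ G.V j) 1 (fun j _ => (hP.2.2 j).le)
  simp at h4
  omega

lemma path_dim {d k : ℕ} (G : LayeredGraph d k) (P : Finset (Fin d)) (hP : G.IsPathSet P)
    (hk : 1 ≤ k) : k + 2 ≤ d := by
  have h1 := hP.2.2 ⟨0, hk⟩
  have h2 : (P ∩ G.V ⟨0, hk⟩).card ≤ (G.V ⟨0, hk⟩).card :=
    Finset.card_le_card Finset.inter_subset_right
  rw [h1, G.hcard] at h2
  have h3 : k ≤ d - 2 := by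
    by_contra h
    rw [Nat.div_eq_of_lt (by omega)] at h2
    omega
  omega

lemma cov_identity {d n : ℕ} {Ω : Type*} (x : Fin n → Ω → Fin d → ℝ) (ω : Ω) (u v : Fin d → ℝ) :
    ip u ((sampleCov x ω).mulVec v) = (n : ℝ)⁻¹ * ∑ i, (x i ω ⬝ᵥ u) * (x i ω ⬝ᵥ v) := by
  have : ip u ((sampleCov x ω).mulVec v) = u ⬝ᵥ (sampleCov x ω).mulVec v := rfl
  rw [this, sampleCov, Matrix.smul_mulVec, dotProduct_smul, smul_eq_mul, Matrix.sum_mulVec,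
    dotProduct_sum]
  congr 1
  apply Finset.sum_congr rfl
  intro i _
  rw [Matrix.vecMulVec_mulVec, dotProduct_smul]
  simp [dotProduct_comm u]

lemma lift_sub {d : ℕ} (lam : ℝ) (vs u v : Fin d → ℝ) :
    lift lam vs (u - v) = lift lam vs u - lift lam vs v := by
  funext o
  cases o with
  | none => simp [lift, ip_sub_right, mul_sub]
  | some i => simp [lift]

lemma lift_sample {d : ℕ} (lam : ℝ) (vs u : Fin d → ℝ) (X : Option (Fin d) → ℝ) (x : Fin d → ℝ)
    (hx : ∀ j, x j = √lam * X none * vs j + X (some j)) :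
    x ⬝ᵥ u = X ⬝ᵥ lift lam vs u := by
  simp only [dotProduct, Fintype.sum_option, lift, Option.elim, ip, hx, add_mul,
    Finset.sum_add_distrib, Finset.mul_sum]
  congr 1
  apply Finset.sum_congr rfl
  intro i _
  ring

lemma opt_identity {d n : ℕ} {Ω : Type*} (lam : ℝ) (vs : Fin d → ℝ) (x : Fin n → Ω → Fin d → ℝ)
    (ω : Ω) (X : Fin n → Option (Fin d) → ℝ)
    (hx : ∀ i j, x i ω j = √lam * X i none * vs j + X i (some j)) (v w : Fin d → ℝ)
    (h : ip vs ((sampleCov x ω).mulVec v) ≤ ip w ((sampleCov x ω).mulVec v)) :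
    0 ≤ lift lam vs (w - vs) ⬝ᵥ lift lam vs v + Bform X (lift lam vs (w - vs)) (lift lam vs v) := by
  have e : lift lam vs (w - vs) ⬝ᵥ lift lam vs v +
      Bform X (lift lam vs (w - vs)) (lift lam vs v) =
      ip w ((sampleCov x ω).mulVec v) - ip vs ((sampleCov x ω).mulVec v) := by
    rw [cov_identity, cov_identity, ← mul_sub, ← Finset.sum_sub_distrib, Bform]
    simp only [lift_sample lam vs _ (X _) (x _ ω) (hx _), lift_sub, dotProduct_sub, sub_mul]
    ring
  rw [e]
  linarith

/-- Deterministic part: on the good event, all the iterates are good. -/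
lemma iterate_bound {d k n : ℕ} (G : LayeredGraph d k) (hk : 1 ≤ k) {Ω : Type*}
    (x : Fin n → Ω → Fin d → ℝ) (ω : Ω) (X : Fin n → Option (Fin d) → ℝ) (lam η : ℝ)
    (hlam : 64 ≤ lam) (hη0 : 0 ≤ η) (hη : η ≤ 1 / 8) (vs : Fin d → ℝ)
    (hx : ∀ i j, x i ω j = √lam * X i none * vs j + X i (some j))
    (hK : ∀ S : Finset (Option (Fin d)), S.card ≤ 10 * k → ∀ u : Option (Fin d) → ℝ,
      (∀ a ∉ S, u a = 0) → |Bform X u u| ≤ η * (u ⬝ᵥ u))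
    (hvs : nrm vs = 1) (hps : G.PathSparse vs) (v : ℕ → Fin d → ℝ)
    (hv0 : nrm (v 0) = 1) (hp0 : G.PathSparse (v 0)) (hc0 : 1 / 2 ≤ ip (v 0) vs)
    (hstep : ∀ t, G.PathSparse (v (t + 1)) ∧ nrm (v (t + 1)) = 1 ∧
          ∀ u : Fin d → ℝ, G.PathSparse u → nrm u = 1 →
            ip u ((sampleCov x ω).mulVec (v t)) ≤
              ip (v (t + 1)) ((sampleCov x ω).mulVec (v t))) (t : ℕ) :
    nrm (v t - vs) ≤ (1 / 2) ^ t * nrm (v 0 - vs) + 4 * η := by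
  have hn : ∀ t, nrm (v t) = 1 := fun t => by
    cases t with
    | zero => exact hv0
    | succ t => exact (hstep t).2.1
  have hp : ∀ t, G.PathSparse (v t) := fun t => by
    cases t with
    | zero => exact hp0
    | succ t => exact (hstep t).1
  have hrel : ∀ t, nrm (v t - vs) ^ 2 = 2 - 2 * ip (v t) vs := by
    intro t
    have h1 : ip (v t) (v t) = 1 := by rw [← nrm_sq, hn]; norm_num
    have h2 : ip vs vs = 1 := by rw [← nrm_sq, hvs]; norm_num
    rw [nrm_sq]
    simp only [ip_sub_left, ip_sub_right, h1, h2, ip_comm vs (v t)]; ring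
  have hone : ∀ t, 1 / 2 ≤ ip (v t) vs →
      nrm (v (t + 1) - vs) ≤ 1 / 8 * nrm (v t - vs) + 2 * η := by
    intro t hc
    obtain ⟨P1, hP1, hs1⟩ := hps
    obtain ⟨P2, hP2, hs2⟩ := hp t
    obtain ⟨P3, hP3, hs3⟩ := hp (t + 1)
    have c1 := path_card G P1 hP1
    have c2 := path_card G P2 hP2
    have c3 := path_card G P3 hP3
    have u1 := Finset.card_union_le P1 P2
    have u2 := Finset.card_union_le (P1 ∪ P2) P3
    have hcard : (insert none ((P1 ∪ P2 ∪ P3).image some) : Finset (Option (Fin d))).card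
        ≤ 10 * k := by
      have a1 := Finset.card_insert_le (none : Option (Fin d)) ((P1 ∪ P2 ∪ P3).image some)
      have a2 := Finset.card_image_le (s := P1 ∪ P2 ∪ P3) (f := (some : Fin d → Option (Fin d)))
      omega
    refine power_step X (insert none ((P1 ∪ P2 ∪ P3).image some)) lam η hlam hη0 hη
      (hK _ hcard) vs (v t) (v (t + 1)) hvs (hn _) (hn _) hc (Finset.mem_insert_self _ _)
      ?_ ?_ ?_ (opt_identity lam vs x ω X hx _ _ ((hstep t).2.2 vs ⟨P1, hP1, hs1⟩ hvs))
    · intro i hi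
      by_contra h
      exact hi (by simp [hs1 i h])
    · intro i hi
      by_contra h
      exact hi (by simp [hs2 i h])
    · intro i hi
      by_contra h
      exact hi (by simp [hs3 i h])
  have key : ∀ t, 1 / 2 ≤ ip (v t) vs ∧
      nrm (v t - vs) ≤ (1 / 2) ^ t * nrm (v 0 - vs) + 4 * η := by
    intro t
    induction t with
    | zero => exact ⟨hc0, by simp; linarith⟩
    | succ t ih =>
      have h1 := hone t ih.1
      have h2 := nrm_nonneg (v t - vs)
      have h3 : nrm (v t - vs) ≤ 1 := by
        have := hrel t
        nlinarith [ih.1]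
      have h4 := nrm_nonneg (v (t + 1) - vs)
      constructor
      · have h5 : nrm (v (t + 1) - vs) ≤ 1 := by linarith
        have := hrel (t + 1)
        nlinarith
      · have h6 := ih.2
        rw [pow_succ]
        linarith
  exact (key t).2

/-- Corollary 2: local convergence of the projected power method
for path-sparse PCA, with high probability. -/
theorem path_sparse_projected_power_method :
    ∃ c C1 C2 C3 : ℝ, 0 < c ∧ 0 < C1 ∧ 0 < C2 ∧ 0 < C3 ∧
      ∀ (d k n : ℕ) (G : LayeredGraph d k),
      ∀ lam : ℝ, C1 ≤ lam → C2 * k * Real.log d ≤ n →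
      ∀ vstar : Fin d → ℝ, G.PathSparse vstar → nrm vstar = 1 →
      ∀ (Ω : Type) (_ : MeasurableSpace Ω) (μ : Measure Ω), IsProbabilityMeasure μ →
      ∀ x : Fin n → Ω → Fin d → ℝ, IsSpikedWishart μ lam vstar x →
      ∀ (v0 : Fin d → ℝ), G.PathSparse v0 → nrm v0 = 1 → 1 / 2 ≤ ip v0 vstar →
      ∀ v : ℕ → Ω → Fin d → ℝ,
        (∀ ω, v 0 ω = v0) →
        (∀ t ω, G.PathSparse (v (t + 1) ω) ∧ nrm (v (t + 1) ω) = 1 ∧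
          ∀ u : Fin d → ℝ, G.PathSparse u → nrm u = 1 →
            ip u ((sampleCov x ω).mulVec (v t ω)) ≤
              ip (v (t + 1) ω) ((sampleCov x ω).mulVec (v t ω))) →
        ENNReal.ofReal (1 - Real.exp (-(c * k))) ≤
          μ {ω | ∀ t : ℕ, 1 ≤ t →
            nrm (v t ω - vstar) ≤
              (1 / 2) ^ t * nrm (v0 - vstar) +
                C3 * Real.sqrt (k * (2 * Real.log d - Real.log k) / n)} := by
  refine ⟨1, 64, 1100000, 520, by norm_num, by norm_num, by norm_num, by norm_num, ?_⟩
  intro d k n G lam hlam hn vstar hps hvs Ω _ μ hμ x hx v0 hp0 hv0 hc0 v hvz hstep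
  rcases Nat.eq_zero_or_pos k with hk | hk
  · subst hk
    simp
  obtain ⟨P, hP, -⟩ := id hps
  have hkd : k + 2 ≤ d := path_dim G P hP hk
  have hd3 : (3 : ℝ) ≤ d := by exact_mod_cast (by omega : 3 ≤ d)
  have hk1 : (1 : ℝ) ≤ k := by exact_mod_cast hk
  have hkd' : (k : ℝ) ≤ d := by exact_mod_cast (by omega : k ≤ d)
  have hlog : 1 ≤ Real.log d := by
    rw [Real.le_log_iff_exp_le (by linarith)]
    linarith [Real.exp_one_lt_d9]
  have hkl : 1 ≤ (k : ℝ) * Real.log d := by nlinarith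
  have hn0 : (0 : ℝ) < n := by
    rw [mul_assoc] at hn
    linarith
  have hn0' : 0 < n := by exact_mod_cast hn0
  obtain ⟨g, hgm, hgi, hgl, hgx⟩ := hx
  let idx : Fin n × Option (Fin d) → Fin n ⊕ Fin n × Fin d := fun p =>
    p.2.elim (Sum.inl p.1) (fun j => Sum.inr (p.1, j))
  have hinj : Function.Injective idx := by
    rintro ⟨i, a⟩ ⟨i', a'⟩ h
    cases a <;> cases a' <;> simp_all [idx]
  set r := √(640 * (k * Real.log d) / n) with hr
  have hr0 : 0 ≤ r := Real.sqrt_nonneg _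
  have hr2 : r ^ 2 = 640 * (k * Real.log d) / n := Real.sq_sqrt (by positivity)
  have hr40 : r ≤ 1 / 40 := by
    rw [hr, Real.sqrt_le_left (by norm_num), div_le_iff₀ hn0]
    rw [mul_assoc] at hn
    linarith
  have hgood := good_event (μ := μ) (H := fun p => g (idx p)) (fun p => hgm _)
    (hgi.precomp hinj) (fun p => hgl _) hn0' (10 * k) (by omega) r hr0 (by linarith)
  have hexp : (n : ℝ) * r ^ 2 / 8 = 80 * (k * Real.log d) := by
    rw [hr2]; field_simp; norm_num
  rw [hexp, Fintype.card_option, Fintype.card_fin] at hgood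
  have hbad := hgood.trans (count_bound d k hk hkd)
  set B : Set Ω := {ω | ¬ ∀ S : Finset (Option (Fin d)), S.card ≤ 10 * k →
    ∀ u : Option (Fin d) → ℝ, (∀ a ∉ S, u a = 0) →
      |Bform (fun i a => g (idx (i, a)) ω) u u| ≤ 5 * r * (u ⬝ᵥ u)} with hB
  have hsub : Bᶜ ⊆ {ω | ∀ t : ℕ, 1 ≤ t →
            nrm (v t ω - vstar) ≤
              (1 / 2) ^ t * nrm (v0 - vstar) +
                520 * Real.sqrt (k * (2 * Real.log d - Real.log k) / n)} := by
    intro ω hω t _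
    have hω' : ∀ S : Finset (Option (Fin d)), S.card ≤ 10 * k →
      ∀ u : Option (Fin d) → ℝ, (∀ a ∉ S, u a = 0) →
      |Bform (fun i a => g (idx (i, a)) ω) u u| ≤ 5 * r * (u ⬝ᵥ u) := by
      by_contra h
      exact hω h
    have h := iterate_bound G hk x ω (fun i a => g (idx (i, a)) ω) lam (5 * r) hlam
      (by linarith) (by linarith) vstar (fun i j => hgx i ω j) hω' hvs hps (fun t => v t ω)
      (by simp only [hvz, hv0]) (by simpa only [hvz] using hp0) (by simpa only [hvz] using hc0)
      (fun t => hstep t ω) t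
    simp only [hvz] at h
    refine h.trans ?_
    have hlk : Real.log k ≤ Real.log d := Real.log_le_log (by linarith) hkd'
    have h1 : 26 * Real.sqrt (k * (2 * Real.log d - Real.log k) / n) ≥ r := by
      have e : 640 * (k * Real.log d) / n ≤
          26 ^ 2 * (k * (2 * Real.log d - Real.log k) / n) := by
        rw [← mul_div_assoc]
        gcongr
        · norm_num
        · linarith
      have := Real.sqrt_le_sqrt e
      rwa [Real.sqrt_mul (by norm_num), Real.sqrt_sq (by norm_num)] at this
    linarith
  refine le_trans ?_ (measure_mono hsub)
  have hU : (1 : ENNReal) ≤ μ Bᶜ + μ B := by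
    rw [← measure_univ (μ := μ), ← Set.compl_union_self B]
    exact measure_union_le _ _
  have hBe : μ B ≤ ENNReal.ofReal (Real.exp (-k)) := by
    rw [← ENNReal.ofReal_toReal (measure_ne_top μ B)]
    exact ENNReal.ofReal_le_ofReal hbad
  rw [ENNReal.ofReal_sub _ (Real.exp_pos _).le, ENNReal.ofReal_one, one_mul, tsub_le_iff_right]
  exact hU.trans (add_le_add_right hBe _)

end StructuredPCA
end
end
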